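/- Let (E_n) be the external DLA process on Z^2 and let H_n denote the number of holes of E_n, i.e. the number of finite connected components of Z^2 \ E_n. Then for every finite connected subset e of Z^2, P[H_n converges to infinity as n → ∞ | E_0 = e] = 1. -/

import Mathlib

open MeasureTheory Filter Topology

/-- The lattice neighbors of a point of `ℤ^d` (the `2d` points at `ℓ¹`-distance one). -/
noncomputable def latNbrs {d : ℕ} (x : Fin d → ℤ) : Finset (Fin d → ℤ) :=
  (Finset.univ ×ˢ ({1, -1} : Finset ℤ)).image (fun p => Function.update x p.1 (x p.1 + p.2))

open Classical in
/-- Probability that the random walk which at each step moves uniformly to one of the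
points in `nbr ·`, started at `x`, hits the set `A` within `n` steps, with first
hitting position `y`. -/
noncomputable def hitP {V : Type*} (nbr : V → Finset V) (A : Set V) : ℕ → V → V → ℝ
  | 0, x, y => if x ∈ A ∧ x = y then 1 else 0
  | n+1, x, y =>
      if x ∈ A then (if x = y then 1 else 0)
      else ((nbr x).card : ℝ)⁻¹ * ∑ z ∈ nbr x, hitP nbr A n z y

/-- The hitting distribution `H_A(x,y)`: probability that the random walk started at `x`
ever hits `A`, with first hitting position `y` (monotone limit of `hitP`). -/
noncomputable def hitMeas {V : Type*} (nbr : V → Finset V) (A : Set V) (x y : V) : ℝ :=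
  ⨆ n, hitP nbr A n x y

/-- Outer boundary of a finite set. -/
noncomputable def bdryF {V : Type*} [DecidableEq V] (nbr : V → Finset V) (A : Finset V) :
    Finset V :=
  A.biUnion nbr \ A

/-- Euclidean norm of a lattice point. -/
noncomputable def eunorm {d : ℕ} (x : Fin d → ℤ) : ℝ := Real.sqrt (∑ i, ((x i : ℝ)) ^ 2)

/-- Radius of a cluster: `r(A) = max {|x| : x ∈ A}`. -/
noncomputable def radE {d : ℕ} (A : Finset (Fin d → ℤ)) : ℝ := ⨆ x ∈ A, eunorm x

/-- Nearest-neighbor adjacency on `ℤ²`. -/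
def adjZ {d : ℕ} (x y : Fin d → ℤ) : Prop := (∑ i, |x i - y i|) = 1

/-- `reach S a b`: `a` and `b` are joined by a nearest-neighbor path staying in `S`. -/
def reach {d : ℕ} (S : Set (Fin d → ℤ)) (a b : Fin d → ℤ) : Prop :=
  Relation.ReflTransGen (fun u v => u ∈ S ∧ v ∈ S ∧ adjZ u v) a b

/-- The holes of a cluster `A ⊆ ℤ²`: the finite connected components of `ℤ² \ A`. -/
def holes {d : ℕ} (A : Finset (Fin d → ℤ)) : Set (Set (Fin d → ℤ)) :=
  {H | ∃ x : Fin d → ℤ, x ∉ A ∧ H = {y | reach (↑A)ᶜ x y} ∧ H.Finite}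

/-- The `ℓ¹`-distance on `ℤ²`. -/
def dist1 (x y : Fin 2 → ℤ) : ℕ := (x 0 - y 0).natAbs + (x 1 - y 1).natAbs

lemma dist1_comm (x y : Fin 2 → ℤ) : dist1 x y = dist1 y x := by
  unfold dist1; omega

lemma dist1_triangle (x y z : Fin 2 → ℤ) : dist1 x z ≤ dist1 x y + dist1 y z := by
  unfold dist1; omega

lemma dist1_self (x : Fin 2 → ℤ) : dist1 x x = 0 := by
  unfold dist1; omega

lemma eq_of_dist1_eq_zero {x y : Fin 2 → ℤ} (h : dist1 x y = 0) : x = y := by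
  unfold dist1 at h
  ext i; fin_cases i <;> simp <;> omega

lemma latNbrs_eq (x : Fin 2 → ℤ) :
    latNbrs x = {![x 0 + 1, x 1], ![x 0 - 1, x 1], ![x 0, x 1 + 1], ![x 0, x 1 - 1]} := by
  have key : ∀ z, z ∈ latNbrs x ↔
      z = ![x 0 + 1, x 1] ∨ z = ![x 0 - 1, x 1] ∨ z = ![x 0, x 1 + 1] ∨ z = ![x 0, x 1 - 1] := by
    intro z
    simp only [latNbrs, Finset.mem_image, Finset.mem_product, Finset.mem_univ, true_and,
      Finset.mem_insert, Finset.mem_singleton, Prod.exists, funext_iff, Fin.forall_fin_two,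
      Fin.exists_fin_two, Function.update_apply]
    simp
    grind
  ext z
  rw [key]
  simp

lemma mem_latNbrs {x z : Fin 2 → ℤ} : z ∈ latNbrs x ↔ dist1 x z = 1 := by
  rw [latNbrs_eq]
  simp only [Finset.mem_insert, Finset.mem_singleton, funext_iff, Fin.forall_fin_two, dist1]
  simp
  omega

lemma mem_latNbrs_comm {x z : Fin 2 → ℤ} : z ∈ latNbrs x ↔ x ∈ latNbrs z := by
  rw [mem_latNbrs, mem_latNbrs, dist1_comm]

lemma sum_latNbrs (x : Fin 2 → ℤ) (g : (Fin 2 → ℤ) → ℝ) :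
    ∑ z ∈ latNbrs x, g z = g ![x 0 + 1, x 1] + g ![x 0 - 1, x 1] + g ![x 0, x 1 + 1]
      + g ![x 0, x 1 - 1] := by
  rw [latNbrs_eq, Finset.sum_insert, Finset.sum_insert, Finset.sum_insert, Finset.sum_singleton]
  · ring
  all_goals simp [funext_iff, Fin.forall_fin_two]
  all_goals omega

lemma card_latNbrs (x : Fin 2 → ℤ) : (latNbrs x).card = 4 := by
  have h := sum_latNbrs x (fun _ => 1)
  simp only [Finset.sum_const, nsmul_eq_mul, mul_one] at h
  exact_mod_cast h.trans (by norm_num : (1 : ℝ) + 1 + 1 + 1 = 4)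

lemma exists_closer {w a : Fin 2 → ℤ} {d : ℕ} (h : dist1 w a = d + 1) :
    ∃ z ∈ latNbrs w, dist1 z a = d := by
  simp only [mem_latNbrs]
  unfold dist1 at *
  rcases lt_trichotomy (w 0) (a 0) with h0 | h0 | h0
  · exact ⟨![w 0 + 1, w 1], by simp; try omega, by simp; omega⟩
  · rcases lt_trichotomy (w 1) (a 1) with h1 | h1 | h1
    · exact ⟨![w 0, w 1 + 1], by simp; try omega, by simp; omega⟩
    · omega
    · exact ⟨![w 0, w 1 - 1], by simp; try omega, by simp; omega⟩
  · exact ⟨![w 0 - 1, w 1], by simp; try omega, by simp; omega⟩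

/-- The finite `ℓ¹`-ball. -/
noncomputable def ball1 (a : Fin 2 → ℤ) (r : ℕ) : Finset (Fin 2 → ℤ) :=
  ((Finset.Icc (-(r : ℤ)) r ×ˢ Finset.Icc (-(r : ℤ)) r).image
    (fun p => ![a 0 + p.1, a 1 + p.2])).filter (fun z => dist1 z a ≤ r)

lemma mem_ball1 {a z : Fin 2 → ℤ} {r : ℕ} : z ∈ ball1 a r ↔ dist1 z a ≤ r := by
  simp only [ball1, Finset.mem_filter, Finset.mem_image, Finset.mem_product, Finset.mem_Icc,
    Prod.exists, and_iff_right_iff_imp]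
  intro h
  refine ⟨z 0 - a 0, z 1 - a 1, ?_, ?_⟩
  · unfold dist1 at h; omega
  · ext i; fin_cases i <;> simp

lemma card_ball1_le (a : Fin 2 → ℤ) (r : ℕ) : (ball1 a r).card ≤ (2 * r + 1) ^ 2 := by
  refine (Finset.card_filter_le _ _).trans (Finset.card_image_le.trans ?_)
  rw [Finset.card_product, Int.card_Icc, sq]
  have : ((r : ℤ) + 1 - -r).toNat = 2 * r + 1 := by omega
  rw [this]

section Hitting

variable {A B C : Set (Fin 2 → ℤ)} {x y : Fin 2 → ℤ}

lemma hitP_mem (hx : x ∈ A) (n : ℕ) (y : Fin 2 → ℤ) :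
    hitP latNbrs A n x y = if x = y then 1 else 0 := by
  cases n <;> simp [hitP, hx]

lemma hitP_succ (hx : x ∉ A) (n : ℕ) (y : Fin 2 → ℤ) :
    hitP latNbrs A (n + 1) x y = 1 / 4 * ∑ z ∈ latNbrs x, hitP latNbrs A n z y := by
  simp [hitP, hx, card_latNbrs]

lemma hitP_zero (hx : x ∉ A) (y : Fin 2 → ℤ) : hitP latNbrs A 0 x y = 0 := by
  simp [hitP, hx]

lemma hitP_nonneg (A : Set (Fin 2 → ℤ)) (n : ℕ) (x y : Fin 2 → ℤ) :
    0 ≤ hitP latNbrs A n x y := by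
  induction n generalizing x with
  | zero => simp only [hitP]; split_ifs <;> norm_num
  | succ n ih =>
    by_cases hx : x ∈ A
    · rw [hitP_mem hx]; split_ifs <;> norm_num
    · rw [hitP_succ hx]
      exact mul_nonneg (by norm_num) (Finset.sum_nonneg fun z _ => ih z)

lemma avg_const (x : Fin 2 → ℤ) (c : ℝ) : 1 / 4 * ∑ _z ∈ latNbrs x, c = c := by
  rw [Finset.sum_const, card_latNbrs]; ring

lemma avg_mono {x : Fin 2 → ℤ} {f g : (Fin 2 → ℤ) → ℝ} (h : ∀ z ∈ latNbrs x, f z ≤ g z) :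
    1 / 4 * ∑ z ∈ latNbrs x, f z ≤ 1 / 4 * ∑ z ∈ latNbrs x, g z :=
  mul_le_mul_of_nonneg_left (Finset.sum_le_sum h) (by norm_num)

lemma hitP_le_succ (A : Set (Fin 2 → ℤ)) (n : ℕ) (x y : Fin 2 → ℤ) :
    hitP latNbrs A n x y ≤ hitP latNbrs A (n + 1) x y := by
  induction n generalizing x with
  | zero =>
    by_cases hx : x ∈ A
    · rw [hitP_mem hx, hitP_mem hx]
    · rw [hitP_zero hx]; exact hitP_nonneg _ _ _ _
  | succ n ih =>
    by_cases hx : x ∈ A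
    · rw [hitP_mem hx, hitP_mem hx]
    · rw [hitP_succ hx, hitP_succ hx]
      exact avg_mono fun z _ => ih z

lemma hitP_mono (A : Set (Fin 2 → ℤ)) (x y : Fin 2 → ℤ) :
    Monotone fun n => hitP latNbrs A n x y :=
  monotone_nat_of_le_succ fun n => hitP_le_succ A n x y

lemma sum_hitP_le_one (C : Finset (Fin 2 → ℤ)) (n : ℕ) (x : Fin 2 → ℤ) :
    ∑ w ∈ C, hitP latNbrs (↑C) n x w ≤ 1 := by
  induction n generalizing x with
  | zero =>
    by_cases hx : x ∈ C
    · simp [hitP_mem (Finset.mem_coe.2 hx), hx]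
    · simp [hitP_zero (mt Finset.mem_coe.1 hx)]
  | succ n ih =>
    by_cases hx : x ∈ C
    · simp [hitP_mem (Finset.mem_coe.2 hx), hx]
    · simp only [hitP_succ (mt Finset.mem_coe.1 hx)]
      rw [← Finset.mul_sum, Finset.sum_comm]
      exact (avg_mono fun z _ => ih z).trans_eq (avg_const x 1)

lemma hitP_le_one (A : Set (Fin 2 → ℤ)) (n : ℕ) (x y : Fin 2 → ℤ) :
    hitP latNbrs A n x y ≤ 1 := by
  induction n generalizing x with
  | zero => simp only [hitP]; split_ifs <;> norm_num
  | succ n ih =>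
    by_cases hx : x ∈ A
    · rw [hitP_mem hx]; split_ifs <;> norm_num
    · rw [hitP_succ hx]
      exact (avg_mono fun z _ => ih z).trans_eq (avg_const x 1)

lemma tendsto_hitP (A : Set (Fin 2 → ℤ)) (x y : Fin 2 → ℤ) :
    Tendsto (fun n => hitP latNbrs A n x y) atTop (𝓝 (hitMeas latNbrs A x y)) :=
  tendsto_atTop_ciSup (hitP_mono A x y) ⟨1, by rintro _ ⟨n, rfl⟩; exact hitP_le_one A n x y⟩

lemma hitP_le_hitMeas (A : Set (Fin 2 → ℤ)) (n : ℕ) (x y : Fin 2 → ℤ) :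
    hitP latNbrs A n x y ≤ hitMeas latNbrs A x y :=
  (hitP_mono A x y).ge_of_tendsto (tendsto_hitP A x y) n

lemma hitMeas_nonneg (A : Set (Fin 2 → ℤ)) (x y : Fin 2 → ℤ) : 0 ≤ hitMeas latNbrs A x y :=
  (hitP_nonneg A 0 x y).trans (hitP_le_hitMeas A 0 x y)

lemma hitMeas_mem (hx : x ∈ A) (y : Fin 2 → ℤ) :
    hitMeas latNbrs A x y = if x = y then 1 else 0 := by
  simp [hitMeas, hitP_mem hx]

lemma hitMeas_avg (hx : x ∉ A) (y : Fin 2 → ℤ) :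
    hitMeas latNbrs A x y = 1 / 4 * ∑ z ∈ latNbrs x, hitMeas latNbrs A z y := by
  have h1 := (tendsto_hitP A x y).comp (tendsto_add_atTop_nat 1)
  have h2 : Tendsto (fun n => 1 / 4 * ∑ z ∈ latNbrs x, hitP latNbrs A n z y) atTop
      (𝓝 (1 / 4 * ∑ z ∈ latNbrs x, hitMeas latNbrs A z y)) :=
    (tendsto_finsetSum _ fun z _ => tendsto_hitP A z y).const_mul _
  refine tendsto_nhds_unique h1 (h2.congr fun n => ?_)
  simp [hitP_succ hx]

/-- First-entrance decomposition: passing through a larger set `C ⊇ B` on the way to `B`. -/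
lemma sum_hitMeas_mul_le {B : Set (Fin 2 → ℤ)} {C : Finset (Fin 2 → ℤ)} (hBC : B ⊆ ↑C)
    (v y : Fin 2 → ℤ) :
    ∑ w ∈ C, hitMeas latNbrs (↑C) v w * hitMeas latNbrs B w y ≤ hitMeas latNbrs B v y := by
  have key : ∀ n v, ∑ w ∈ C, hitP latNbrs (↑C) n v w * hitMeas latNbrs B w y
      ≤ hitMeas latNbrs B v y := by
    intro n
    induction n with
    | zero =>
      intro v
      by_cases hv : v ∈ C
      · simp [hitP_mem (Finset.mem_coe.2 hv), hv]
      · simp [hitP_zero (mt Finset.mem_coe.1 hv), hitMeas_nonneg]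
    | succ n ih =>
      intro v
      by_cases hv : v ∈ C
      · simp [hitP_mem (Finset.mem_coe.2 hv), hv]
      · rw [hitMeas_avg (fun h => hv (Finset.mem_coe.1 (hBC h)))]
        simp only [hitP_succ (mt Finset.mem_coe.1 hv), mul_assoc, Finset.sum_mul]
        rw [← Finset.mul_sum, Finset.sum_comm]
        exact avg_mono fun z _ => ih z
  exact le_of_tendsto (tendsto_finsetSum _ fun w _ => (tendsto_hitP _ v w).mul_const _)
    (Eventually.of_forall fun n => key n v)

/-- The walk cannot enter `S` if leaving the complement of `S` requires stepping on `C`. -/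
lemma hitMeas_eq_zero {S : Set (Fin 2 → ℤ)}
    (hS : ∀ u, u ∉ C → u ∉ S → ∀ z ∈ latNbrs u, z ∉ S) {v w : Fin 2 → ℤ} (hv : v ∉ S)
    (hw : w ∈ S) : hitMeas latNbrs C v w = 0 := by
  have key : ∀ n v, v ∉ S → hitP latNbrs C n v w = 0 := by
    intro n
    induction n with
    | zero =>
      intro v hv
      have : v ≠ w := by rintro rfl; exact hv hw
      simp [hitP, this]
    | succ n ih =>
      intro v hv
      by_cases hC : v ∈ C
      · have : v ≠ w := by rintro rfl; exact hv hw
        simp [hitP_mem hC, this]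
      · rw [hitP_succ hC, Finset.sum_eq_zero fun z hz => ih z (hS v hC hv z hz), mul_zero]
  exact tendsto_nhds_unique (tendsto_hitP C v w)
    (tendsto_const_nhds.congr fun n => (key n v hv).symm)

lemma quarter_mul_le_hitMeas {B : Set (Fin 2 → ℤ)} {u z y : Fin 2 → ℤ} (hu : u ∉ B)
    (hz : z ∈ latNbrs u) : 1 / 4 * hitMeas latNbrs B z y ≤ hitMeas latNbrs B u y := by
  rw [hitMeas_avg hu]
  exact mul_le_mul_of_nonneg_left
    (Finset.single_le_sum (f := fun z => hitMeas latNbrs B z y)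
      (fun z _ => hitMeas_nonneg B z y) hz) (by norm_num)

end Hitting

section Recurrence

/-- A finitely supported positive part together with subharmonicity on it forces `h ≤ 0`. -/
lemma nonpos_of_subharmonic {h : (Fin 2 → ℤ) → ℝ} (hfin : {v | 0 < h v}.Finite)
    (hsub : ∀ v, 0 < h v → h v ≤ 1 / 4 * ∑ z ∈ latNbrs v, h z) (v : Fin 2 → ℤ) : h v ≤ 0 := by
  by_contra! hv
  obtain ⟨m, hm, hmax⟩ := Set.exists_max_image _ h hfin ⟨v, hv⟩
  have hle : ∀ z, h z ≤ h m := fun z => by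
    by_cases hz : 0 < h z
    · exact hmax z hz
    · exact (not_lt.1 hz).trans (le_of_lt hm)
  obtain ⟨u, hu, humax⟩ := Set.exists_max_image {u | h u = h m} (fun u => u 0)
    (hfin.subset fun u (hu : h u = h m) => by rw [Set.mem_ofPred_eq, hu]; exact hm) ⟨m, rfl⟩
  have hu' : h u = h m := hu
  have h1 := hsub u (by rw [hu']; exact hm)
  rw [sum_latNbrs] at h1
  have h2 : h ![u 0 + 1, u 1] = h m := by
    have a1 := hle ![u 0 + 1, u 1]
    have a2 := hle ![u 0 - 1, u 1]
    have a3 := hle ![u 0, u 1 + 1]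
    have a4 := hle ![u 0, u 1 - 1]
    linarith
  have h3 : (![u 0 + 1, u 1] : Fin 2 → ℤ) 0 ≤ u 0 := humax _ h2
  simp at h3

/-- Exponential of a Lyapunov function for the planar walk. -/
noncomputable def expLyap (a b : ℤ) : ℝ :=
  if a = 0 ∧ b = 0 then 1 else 63 * (2 * ((a : ℝ) ^ 2 + (b : ℝ) ^ 2) - 1)

lemma expLyap_eq {a b : ℤ} (h : a ≠ 0 ∨ b ≠ 0) :
    expLyap a b = 63 * (2 * ((a : ℝ) ^ 2 + (b : ℝ) ^ 2) - 1) := by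
  rw [expLyap, if_neg (by tauto)]

lemma one_le_sq_add_sq {a b : ℤ} (h : a ≠ 0 ∨ b ≠ 0) : (1 : ℝ) ≤ (a : ℝ) ^ 2 + (b : ℝ) ^ 2 := by
  have h1 : (1 : ℤ) ≤ a ^ 2 + b ^ 2 := by
    rcases h with h | h
    · have := sq_nonneg b; have : 0 < a ^ 2 := by positivity
      omega
    · have := sq_nonneg a; have : 0 < b ^ 2 := by positivity
      omega
  exact_mod_cast h1

lemma sq_add_sq_le_expLyap (a b : ℤ) : (a : ℝ) ^ 2 + (b : ℝ) ^ 2 ≤ expLyap a b := by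
  by_cases h : a ≠ 0 ∨ b ≠ 0
  · rw [expLyap_eq h]; have := one_le_sq_add_sq h; linarith
  · push Not at h
    rw [expLyap, if_pos h, h.1, h.2]; norm_num

lemma one_le_expLyap (a b : ℤ) : 1 ≤ expLyap a b := by
  by_cases h : a ≠ 0 ∨ b ≠ 0
  · exact (one_le_sq_add_sq h).trans (sq_add_sq_le_expLyap a b)
  · push Not at h
    rw [expLyap, if_pos h]

lemma expLyap_mul_le {a b : ℤ} (h : a ≠ 0 ∨ b ≠ 0) :
    expLyap (a + 1) b * expLyap (a - 1) b * expLyap a (b + 1) * expLyap a (b - 1)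
      ≤ expLyap a b ^ 4 := by
  by_cases h1 : a ^ 2 + b ^ 2 = 1
  · have ha : -1 ≤ a ∧ a ≤ 1 := ⟨by nlinarith [sq_nonneg b], by nlinarith [sq_nonneg b]⟩
    have hb : -1 ≤ b ∧ b ≤ 1 := ⟨by nlinarith [sq_nonneg a], by nlinarith [sq_nonneg a]⟩
    obtain ⟨ha1, ha2⟩ := ha
    obtain ⟨hb1, hb2⟩ := hb
    interval_cases a <;> interval_cases b <;> first | omega | (norm_num [expLyap])
  · have h2 : (2 : ℤ) ≤ a ^ 2 + b ^ 2 := by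
      have := one_le_sq_add_sq h
      have : (1 : ℤ) ≤ a ^ 2 + b ^ 2 := by exact_mod_cast this
      omega
    have n1 : a + 1 ≠ 0 ∨ b ≠ 0 := by
      by_contra! hc; obtain ⟨hc, rfl⟩ := hc
      obtain rfl : a = -1 := by omega
      norm_num at h2
    have n2 : a - 1 ≠ 0 ∨ b ≠ 0 := by
      by_contra! hc; obtain ⟨hc, rfl⟩ := hc
      obtain rfl : a = 1 := by omega
      norm_num at h2
    have n3 : a ≠ 0 ∨ b + 1 ≠ 0 := by
      by_contra! hc; obtain ⟨rfl, hc⟩ := hc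
      obtain rfl : b = -1 := by omega
      norm_num at h2
    have n4 : a ≠ 0 ∨ b - 1 ≠ 0 := by
      by_contra! hc; obtain ⟨rfl, hc⟩ := hc
      obtain rfl : b = 1 := by omega
      norm_num at h2
    rw [expLyap_eq n1, expLyap_eq n2, expLyap_eq n3, expLyap_eq n4, expLyap_eq h]
    have h3 : (2 : ℝ) ≤ (a : ℝ) ^ 2 + (b : ℝ) ^ 2 := by exact_mod_cast h2
    push_cast
    set p : ℝ := (a : ℝ) ^ 2 with hp
    set q : ℝ := (b : ℝ) ^ 2 with hq
    have hp0 : 0 ≤ p := by positivity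
    have hq0 : 0 ≤ q := by positivity
    have key : ((2 * (p + q) + 1) ^ 2 - 16 * p) * ((2 * (p + q) + 1) ^ 2 - 16 * q)
        ≤ (2 * (p + q) - 1) ^ 4 := by
      have h4 : p * q ≤ (p + q) ^ 2 / 4 := by nlinarith [sq_nonneg (p - q)]
      nlinarith
    have e : 63 * (2 * (((a : ℝ) + 1) ^ 2 + q) - 1) * (63 * (2 * (((a : ℝ) - 1) ^ 2 + q) - 1))
        * (63 * (2 * (p + ((b : ℝ) + 1) ^ 2) - 1)) * (63 * (2 * (p + ((b : ℝ) - 1) ^ 2) - 1))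
        = 63 ^ 4 * (((2 * (p + q) + 1) ^ 2 - 16 * p) * ((2 * (p + q) + 1) ^ 2 - 16 * q)) := by
      rw [hp, hq]; ring
    rw [e, mul_pow]
    exact mul_le_mul_of_nonneg_left key (by norm_num)

/-- A nonnegative proper function, superharmonic away from `c`. -/
noncomputable def lyap (c x : Fin 2 → ℤ) : ℝ := Real.log (expLyap (x 0 - c 0) (x 1 - c 1))

lemma lyap_nonneg (c x : Fin 2 → ℤ) : 0 ≤ lyap c x := Real.log_nonneg (one_le_expLyap _ _)

lemma lyap_superharmonic {c x : Fin 2 → ℤ} (h : x ≠ c) :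
    1 / 4 * ∑ z ∈ latNbrs x, lyap c z ≤ lyap c x := by
  have hne : x 0 - c 0 ≠ 0 ∨ x 1 - c 1 ≠ 0 := by
    by_contra! hc
    exact h (eq_of_dist1_eq_zero (by unfold dist1; omega))
  have hpos : ∀ a b, 0 < expLyap a b := fun a b => zero_lt_one.trans_le (one_le_expLyap a b)
  have h1 := Real.log_le_log
    (mul_pos (mul_pos (mul_pos (hpos _ _) (hpos _ _)) (hpos _ _)) (hpos _ _)) (expLyap_mul_le hne)
  rw [Real.log_mul, Real.log_mul, Real.log_mul, Real.log_pow] at h1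
  · rw [sum_latNbrs]
    simp only [lyap, Matrix.cons_val_zero, Matrix.cons_val_one]
    rw [show x 0 + 1 - c 0 = x 0 - c 0 + 1 by ring, show x 0 - 1 - c 0 = x 0 - c 0 - 1 by ring,
      show x 1 + 1 - c 1 = x 1 - c 1 + 1 by ring, show x 1 - 1 - c 1 = x 1 - c 1 - 1 by ring]
    push_cast at h1
    linarith
  all_goals simp only [ne_eq, mul_eq_zero, (hpos _ _).ne', or_self, not_false_eq_true]

lemma finite_lyap_lt (c : Fin 2 → ℤ) (M : ℝ) : {x | lyap c x < M}.Finite := by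
  obtain ⟨r, hr⟩ := exists_nat_ge (Real.exp M)
  refine (ball1 c (2 * r)).finite_toSet.subset fun x hx => ?_
  have h1 : expLyap (x 0 - c 0) (x 1 - c 1) < Real.exp M := by
    rw [← Real.log_lt_iff_lt_exp (zero_lt_one.trans_le (one_le_expLyap _ _))]; exact hx
  have h2 := sq_add_sq_le_expLyap (x 0 - c 0) (x 1 - c 1)
  have h3 : (x 0 - c 0) ^ 2 + (x 1 - c 1) ^ 2 ≤ (r : ℤ) := by
    have : (((x 0 - c 0) ^ 2 + (x 1 - c 1) ^ 2 : ℤ) : ℝ) ≤ ((r : ℤ) : ℝ) := by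
      push_cast at h2 ⊢; linarith
    exact_mod_cast this
  have h4 := Int.natAbs_le_self_sq (x 0 - c 0)
  have h5 := Int.natAbs_le_self_sq (x 1 - c 1)
  rw [Finset.mem_coe, mem_ball1]
  unfold dist1
  have := sq_nonneg (x 0 - c 0)
  have := sq_nonneg (x 1 - c 1)
  omega

lemma sum_hitMeas_le_one (C : Finset (Fin 2 → ℤ)) (v : Fin 2 → ℤ) :
    ∑ w ∈ C, hitMeas latNbrs (↑C) v w ≤ 1 :=
  le_of_tendsto (tendsto_finsetSum _ fun w _ => tendsto_hitP _ v w)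
    (Eventually.of_forall fun n => sum_hitP_le_one C n v)

/-- Recurrence of the planar walk: a nonempty finite set is hit with probability one. -/
lemma sum_hitMeas_eq_one {C : Finset (Fin 2 → ℤ)} (hC : C.Nonempty) (v : Fin 2 → ℤ) :
    ∑ w ∈ C, hitMeas latNbrs (↑C) v w = 1 := by
  obtain ⟨c, hc⟩ := hC
  refine le_antisymm (sum_hitMeas_le_one C v) ?_
  set r : (Fin 2 → ℤ) → ℝ := fun v => 1 - ∑ w ∈ C, hitMeas latNbrs (↑C) v w with hr
  have hr1 : ∀ v, r v ≤ 1 := fun v => by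
    have := Finset.sum_nonneg fun w (_ : w ∈ C) => hitMeas_nonneg (↑C) v w
    simp only [hr]; linarith
  have hrC : ∀ v ∈ C, r v = 0 := fun v hv => by
    simp [hr, hitMeas_mem (Finset.mem_coe.2 hv), hv]
  have hravg : ∀ v, v ∉ C → r v = 1 / 4 * ∑ z ∈ latNbrs v, r z := fun v hv => by
    simp only [hr, Finset.sum_sub_distrib, mul_sub, avg_const]
    rw [Finset.sum_comm, Finset.mul_sum]
    simp only [hitMeas_avg (mt Finset.mem_coe.1 hv)]
  have key : ∀ ε : ℝ, 0 < ε → r v ≤ ε * lyap c v := fun ε hε => by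
    suffices r v - ε * lyap c v ≤ 0 by linarith
    refine nonpos_of_subharmonic (h := fun v => r v - ε * lyap c v) ?_ ?_ v
    · refine (finite_lyap_lt c (1 / ε)).subset fun x hx => ?_
      have hx' : 0 < r x - ε * lyap c x := hx
      rw [Set.mem_ofPred_eq, lt_div_iff₀ hε]
      linarith [hr1 x]
    · intro x hx
      have hxC : x ∉ C := fun h => by
        rw [hrC x h] at hx
        have := mul_nonneg hε.le (lyap_nonneg c x)
        linarith
      have h1 := lyap_superharmonic (c := c) (x := x) (by rintro rfl; exact hxC hc)
      rw [Finset.sum_sub_distrib, mul_sub, ← hravg x hxC, ← Finset.mul_sum]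
      have := mul_le_mul_of_nonneg_left h1 hε.le
      linarith
  have h0 : Tendsto (fun ε : ℝ => ε * lyap c v) (𝓝[>] 0) (𝓝 0) := by
    have : Tendsto (fun ε : ℝ => ε * lyap c v) (𝓝 0) (𝓝 (0 * lyap c v)) :=
      tendsto_id.mul_const _
    rw [zero_mul] at this
    exact this.mono_left nhdsWithin_le_nhds
  have := ge_of_tendsto h0 (eventually_mem_nhdsWithin.mono fun ε hε => key ε hε)
  simp only [hr] at this
  linarith

end Recurrence

/-- `μ` is the harmonic measure from infinity. -/
def IsHarmonicFromInfinity (μ : Finset (Fin 2 → ℤ) → (Fin 2 → ℤ) → ℝ) : Prop :=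
  ∀ A : Finset (Fin 2 → ℤ), A.Nonempty → ∀ y ∈ A,
    Tendsto (fun x => hitMeas latNbrs (↑A) x y) cofinite (𝓝 (μ A y))

namespace IsHarmonicFromInfinity

variable {μ : Finset (Fin 2 → ℤ) → (Fin 2 → ℤ) → ℝ} (hμ : IsHarmonicFromInfinity μ)
include hμ

lemma nonneg {A : Finset (Fin 2 → ℤ)} {y : Fin 2 → ℤ} (hy : y ∈ A) : 0 ≤ μ A y :=
  ge_of_tendsto (hμ A ⟨y, hy⟩ y hy) (Eventually.of_forall fun x => hitMeas_nonneg _ x y)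

lemma sum_eq_one {A : Finset (Fin 2 → ℤ)} (hA : A.Nonempty) : ∑ y ∈ A, μ A y = 1 := by
  refine tendsto_nhds_unique (tendsto_finsetSum A fun y hy => hμ A hA y hy) ?_
  exact tendsto_const_nhds.congr fun v => (sum_hitMeas_eq_one hA v).symm

lemma sum_mul_hitMeas_le {B C : Finset (Fin 2 → ℤ)} (hBC : B ⊆ C) {y : Fin 2 → ℤ} (hy : y ∈ B) :
    ∑ w ∈ C, μ C w * hitMeas latNbrs (↑B) w y ≤ μ B y := by
  have hC : C.Nonempty := ⟨y, hBC hy⟩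
  exact le_of_tendsto_of_tendsto
    (tendsto_finsetSum C fun w hw => (hμ C hC w hw).mul_const _) (hμ B ⟨y, hy⟩ y hy)
    (Eventually.of_forall fun v => sum_hitMeas_mul_le (Finset.coe_subset.2 hBC) v y)

lemma eq_zero_of_barrier {C : Finset (Fin 2 → ℤ)} {S : Set (Fin 2 → ℤ)} (hfin : S.Finite)
    (hS : ∀ u, u ∉ C → u ∉ S → ∀ z ∈ latNbrs u, z ∉ S) {w : Fin 2 → ℤ} (hwC : w ∈ C)
    (hw : w ∈ S) : μ C w = 0 := by
  refine tendsto_nhds_unique (hμ C ⟨w, hwC⟩ w hwC) (tendsto_const_nhds.congr' ?_)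
  filter_upwards [hfin.compl_mem_cofinite] with v hv
  exact (hitMeas_eq_zero (fun u hu => hS u (mt Finset.mem_coe.2 hu)) hv hw).symm

end IsHarmonicFromInfinity

section Plan

/-- A construction plan: cells `s 0, …, s 13` to be added in this order to a cluster containing
`a` and otherwise at distance at least `12` from `x`; each one can be reached from `x` at the time
it has to be added, and the last one encloses a single site. -/
structure IsPlan (x a : Fin 2 → ℤ) (s : ℕ → Fin 2 → ℤ) : Prop where
  dist_lt : ∀ i < 14, dist1 (s i) x < 12
  ne : ∀ i < 14, ∀ j < i, s i ≠ s j
  near : ∀ i < 14, dist1 (s i) a ≤ 11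
  adj : ∀ i < 14, s i ∈ latNbrs a ∨ ∃ j < i, s i ∈ latNbrs (s j)
  approach : ∀ i < 14, ∀ B : Set (Fin 2 → ℤ),
    (∀ z, dist1 z x ≤ 10 → (∀ j < i, z ∉ latNbrs (s j)) → z ∉ B) → s i ∈ B →
      (1 / 4 : ℝ) ^ 12 ≤ hitMeas latNbrs B x (s i)
  hole : ∃ o, dist1 o x < 12 ∧ (∀ j < 14, o ≠ s j) ∧ (∀ z ∈ latNbrs o, ∃ j < 14, z = s j) ∧
    s 13 ∈ latNbrs o

/-- The `ℓ¹`-distance in model coordinates. -/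
def modelDist (u v : ℤ × ℤ) : ℕ := (u.1 - v.1).natAbs + (u.2 - v.2).natAbs

/-- A geodesic from the origin through `(p, 0)`, bending there. -/
def modelGeodesic (p d : ℕ) : ℤ × ℤ := (min d p, d - min d p)

/-- The cells of the plan in model coordinates. -/
def modelCell (p : ℕ) : ℕ → ℤ × ℤ
  | 8 => (4, 1)
  | 9 => (3, 1)
  | 10 => (2, 1)
  | 11 => (2, 0)
  | 12 => (4, -1)
  | 13 => (3, -1)
  | t => modelGeodesic p (11 - t)

/-- Approach paths from the origin to the cells of the plan. -/
def modelPath (p : ℕ) : ℕ → List (ℤ × ℤ)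
  | 8 => [(0, 1), (0, 2), (1, 2), (2, 2), (3, 2), (4, 2), (4, 1)]
  | 9 => [(0, 1), (1, 1), (2, 1), (3, 1)]
  | 10 => [(0, 1), (1, 1), (2, 1)]
  | 11 => [(1, 0), (2, 0)]
  | 12 => [(0, -1), (0, -2), (1, -2), (2, -2), (3, -2), (4, -2), (4, -1)]
  | 13 => [(0, -1), (0, -2), (1, -2), (2, -2), (3, -2), (3, -1)]
  | t => (List.range (11 - t)).map fun d => modelGeodesic p (d + 1)

/-- The list `l` continues `z` to a path ending in `y` whose sites before `y` are close to the
origin and not adjacent to the first `i` cells of the plan. -/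
def IsModelApproach (p i : ℕ) (y : ℤ × ℤ) : List (ℤ × ℤ) → ℤ × ℤ → Prop
  | [], z => z = y
  | w :: l, z => (∀ j < i, modelDist (modelCell p j) z ≠ 1) ∧ modelDist z (0, 0) ≤ 10 ∧
      modelDist z w = 1 ∧ IsModelApproach p i y l w

lemma modelCell_cases (p : ℕ) {j : ℕ} (hj : j < 14) :
    (j ≤ 7 ∧ modelCell p j = modelGeodesic p (11 - j)) ∨ (j = 8 ∧ modelCell p j = (4, 1)) ∨
      (j = 9 ∧ modelCell p j = (3, 1)) ∨ (j = 10 ∧ modelCell p j = (2, 1)) ∨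
      (j = 11 ∧ modelCell p j = (2, 0)) ∨ (j = 12 ∧ modelCell p j = (4, -1)) ∨
      (j = 13 ∧ modelCell p j = (3, -1)) := by
  interval_cases j <;> simp [modelCell]

lemma isModelApproach_modelGeodesic {p i : ℕ} (hp : 6 ≤ p) (hi : i ≤ 7) (m d : ℕ)
    (h : d + m = 11 - i) :
    IsModelApproach p i (modelGeodesic p (11 - i))
      ((List.range m).map fun t => modelGeodesic p (d + t + 1)) (modelGeodesic p d) := by
  induction m generalizing d with
  | zero => rw [← h]; rfl
  | succ m ih =>
    rw [List.range_succ_eq_map, List.map_cons, List.map_map]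
    refine ⟨fun j hj => ?_, ?_, ?_, ?_⟩
    · have hj' := modelCell_cases p (j := j) (by omega)
      rcases hj' with ⟨-, h⟩ | h | h | h | h | h | h
      · rw [h]
        simp only [modelDist, modelGeodesic]
        omega
      all_goals omega
    · simp only [modelDist, modelGeodesic]
      omega
    · simp only [modelDist, modelGeodesic]
      omega
    · convert ih (d + 1) (by omega) using 2
      funext t
      simp only [Function.comp_apply]
      congr 1
      omega

lemma modelPath_spec (k : ℕ) (hk : k < 7) (i : ℕ) (hi : i < 14) :
    IsModelApproach (6 + k) i (modelCell (6 + k) i) (modelPath (6 + k) i) (0, 0) ∧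
      (modelPath (6 + k) i).length ≤ 12 := by
  have hfar : ∀ u v : ℤ, (∀ j < 8, j < i → modelDist (modelGeodesic (6 + k) (11 - j)) (u, v) ≠ 1) →
      (8 < i → modelDist (4, 1) (u, v) ≠ 1) → (9 < i → modelDist (3, 1) (u, v) ≠ 1) →
      (10 < i → modelDist (2, 1) (u, v) ≠ 1) → (11 < i → modelDist (2, 0) (u, v) ≠ 1) →
      (12 < i → modelDist (4, -1) (u, v) ≠ 1) →
      ∀ j < i, modelDist (modelCell (6 + k) j) (u, v) ≠ 1 := by
    intro u v h1 h2 h3 h4 h5 h6 j hj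
    rcases modelCell_cases (6 + k) (j := j) (by omega) with
      ⟨h7, h⟩ | ⟨rfl, h⟩ | ⟨rfl, h⟩ | ⟨rfl, h⟩ | ⟨rfl, h⟩ | ⟨rfl, h⟩ | ⟨rfl, h⟩
    · rw [h]; exact h1 j (by omega) hj
    · rw [h]; exact h2 hj
    · rw [h]; exact h3 hj
    · rw [h]; exact h4 hj
    · rw [h]; exact h5 hj
    · rw [h]; exact h6 hj
    · omega
  rcases le_or_gt i 7 with h7 | h7
  · have hc : modelCell (6 + k) i = modelGeodesic (6 + k) (11 - i) := by
      interval_cases i <;> rfl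
    have hp : modelPath (6 + k) i =
        (List.range (11 - i)).map fun t => modelGeodesic (6 + k) (0 + t + 1) := by
      simp only [zero_add]
      interval_cases i <;> rfl
    have h0 : modelGeodesic (6 + k) 0 = (0, 0) := by
      simp [modelGeodesic]
      omega
    rw [hc, hp, ← h0]
    exact ⟨isModelApproach_modelGeodesic (by omega) h7 _ 0 (by omega), by simp; omega⟩
  · interval_cases i <;> simp only [modelPath, IsModelApproach] <;>
      refine ⟨?_, by decide⟩ <;> (repeat' refine And.intro ?_ ?_) <;>
      first
      | rfl
      | decide
      | (apply hfar <;>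
          first
          | decide
          | (intro j hj _; simp only [modelDist, modelGeodesic]; omega))

lemma modelCell_spec (k : ℕ) (hk : k < 7) (i : ℕ) (hi : i < 14) :
    modelDist (modelCell (6 + k) i) (0, 0) < 12 ∧
    (∀ j < i, modelDist (modelCell (6 + k) i) (modelCell (6 + k) j) ≠ 0) ∧
    modelDist (modelCell (6 + k) i) (6 + k, 6 - k) ≤ 11 ∧
    (modelDist (6 + k, 6 - k) (modelCell (6 + k) i) = 1 ∨
      ∃ j < i, modelDist (modelCell (6 + k) j) (modelCell (6 + k) i) = 1) ∧
    modelDist (3, 0) (modelCell (6 + k) i) ≠ 0 := by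
  refine ⟨?_, fun j hj => ?_, ?_, ?_, ?_⟩
  · rcases modelCell_cases (6 + k) hi with h | h | h | h | h | h | h <;> rw [h.2] <;>
      simp only [modelDist, modelGeodesic] <;> omega
  · rcases modelCell_cases (6 + k) hi with h | h | h | h | h | h | h <;> rw [h.2] <;>
      rcases modelCell_cases (6 + k) (hj.trans hi) with h' | h' | h' | h' | h' | h' | h' <;>
      rw [h'.2] <;> simp only [modelDist, modelGeodesic] <;> omega
  · rcases modelCell_cases (6 + k) hi with h | h | h | h | h | h | h <;> rw [h.2] <;>
      simp only [modelDist, modelGeodesic] <;> omega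
  · rcases Nat.eq_zero_or_pos i with rfl | hi0
    · left
      simp only [modelDist, modelCell, modelGeodesic]
      omega
    · right
      rcases le_or_gt i 11 with h11 | h11
      · refine ⟨i - 1, by omega, ?_⟩
        interval_cases i <;> simp only [modelDist, modelCell, modelGeodesic, Nat.reduceSub] <;>
          omega
      · interval_cases i
        · exact ⟨7, by norm_num, by simp only [modelDist, modelCell, modelGeodesic]; omega⟩
        · exact ⟨12, by norm_num, by simp only [modelDist, modelCell]; omega⟩
  · rcases modelCell_cases (6 + k) hi with h | h | h | h | h | h | h <;> rw [h.2] <;>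
      simp only [modelDist, modelGeodesic] <;> omega

lemma modelCell_hole (k : ℕ) (hk : k < 7) (u : ℤ × ℤ) (hu : modelDist (3, 0) u = 1) :
    ∃ j < 14, u = modelCell (6 + k) j := by
  obtain ⟨u, v⟩ := u
  have h7 : modelCell (6 + k) 7 = (4, 0) := by
    simp only [modelCell, modelGeodesic, Prod.mk.injEq]
    omega
  have h : (u = 4 ∧ v = 0) ∨ (u = 2 ∧ v = 0) ∨ (u = 3 ∧ v = 1) ∨ (u = 3 ∧ v = -1) := by
    simp only [modelDist] at hu
    omega
  rcases h with ⟨rfl, rfl⟩ | ⟨rfl, rfl⟩ | ⟨rfl, rfl⟩ | ⟨rfl, rfl⟩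
  exacts [⟨7, by norm_num, h7.symm⟩, ⟨11, by norm_num, rfl⟩, ⟨9, by norm_num, rfl⟩,
    ⟨13, by norm_num, rfl⟩]

/-- A symmetry of the lattice moving the model configuration to given endpoints. -/
lemma exists_model_isometry {x a : Fin 2 → ℤ} (h : dist1 x a = 12) :
    ∃ (φ : ℤ × ℤ → Fin 2 → ℤ) (ψ : (Fin 2 → ℤ) → ℤ × ℤ) (k : ℕ),
      (∀ u v, dist1 (φ u) (φ v) = modelDist u v) ∧ (∀ z, φ (ψ z) = z) ∧ φ (0, 0) = x ∧
        k < 7 ∧ φ (6 + k, 6 - k) = a := by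
  have key : ∀ (σ τ : ℤ) (b : Bool), σ * σ = 1 → τ * τ = 1 →
      ∀ φ : ℤ × ℤ → Fin 2 → ℤ, (φ = fun u => ![x 0 + σ * (if b then u.1 else u.2),
        x 1 + τ * (if b then u.2 else u.1)]) →
      ∃ ψ : (Fin 2 → ℤ) → ℤ × ℤ,
        (∀ u v, dist1 (φ u) (φ v) = modelDist u v) ∧ (∀ z, φ (ψ z) = z) ∧ φ (0, 0) = x := by
    rintro σ τ b hσ hτ φ rfl
    refine ⟨fun z => if b then (σ * (z 0 - x 0), τ * (z 1 - x 1))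
      else (τ * (z 1 - x 1), σ * (z 0 - x 0)), ?_, ?_, ?_⟩
    · intro u v
      rcases mul_self_eq_one_iff.1 hσ with rfl | rfl <;>
      rcases mul_self_eq_one_iff.1 hτ with rfl | rfl <;> cases b <;>
      simp [dist1, modelDist] <;> omega
    · intro z
      ext i
      fin_cases i <;> cases b <;> simp [← mul_assoc, hσ, hτ]
    · ext i
      fin_cases i <;> cases b <;> simp
  have hs : ∀ t : ℤ, ∃ σ : ℤ, σ * σ = 1 ∧ σ * t.natAbs = t := fun t => by
    rcases le_total 0 t with ht | ht
    · exact ⟨1, by norm_num, by omega⟩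
    · exact ⟨-1, by norm_num, by omega⟩
  obtain ⟨σ, hσ, hσ'⟩ := hs (a 0 - x 0)
  obtain ⟨τ, hτ, hτ'⟩ := hs (a 1 - x 1)
  unfold dist1 at h
  rcases le_total (a 0 - x 0).natAbs (a 1 - x 1).natAbs with hle | hle
  · obtain ⟨ψ, h1, h2, h3⟩ := key σ τ false hσ hτ _ rfl
    refine ⟨_, ψ, (a 1 - x 1).natAbs - 6, h1, h2, h3, by omega, ?_⟩
    rw [show (6 + ((a 1 - x 1).natAbs - 6 : ℕ) : ℤ) = (a 1 - x 1).natAbs by omega,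
      show (6 - ((a 1 - x 1).natAbs - 6 : ℕ) : ℤ) = (a 0 - x 0).natAbs by omega]
    ext i
    fin_cases i
    · simp only [Fin.zero_eta, Bool.false_eq_true, if_false, Matrix.cons_val_zero, hσ']; ring
    · simp only [Fin.mk_one, Bool.false_eq_true, if_false, Matrix.cons_val_one,
        Matrix.cons_val_fin_one, hτ']; ring
  · obtain ⟨ψ, h1, h2, h3⟩ := key σ τ true hσ hτ _ rfl
    refine ⟨_, ψ, (a 0 - x 0).natAbs - 6, h1, h2, h3, by omega, ?_⟩
    rw [show (6 + ((a 0 - x 0).natAbs - 6 : ℕ) : ℤ) = (a 0 - x 0).natAbs by omega,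
      show (6 - ((a 0 - x 0).natAbs - 6 : ℕ) : ℤ) = (a 1 - x 1).natAbs by omega]
    ext i
    fin_cases i
    · simp only [Fin.zero_eta, if_true, Matrix.cons_val_zero, hσ']; ring
    · simp only [Fin.mk_one, if_true, Matrix.cons_val_one, Matrix.cons_val_fin_one, hτ']; ring

lemma exists_isPlan {x a : Fin 2 → ℤ} (h : dist1 x a = 12) : ∃ s, IsPlan x a s := by
  obtain ⟨φ, ψ, k, hφ, hψ, h0, hk, ha⟩ := exists_model_isometry h
  have hcell := modelCell_spec k hk
  refine ⟨fun i => φ (modelCell (6 + k) i), ?_, ?_, ?_, ?_, ?_, ?_⟩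
  · intro i hi
    rw [← h0, hφ]; exact (hcell i hi).1
  · intro i hi j hj hij
    exact (hcell i hi).2.1 j hj (by rw [← hφ, hij, dist1_self])
  · intro i hi
    rw [← ha, hφ]; exact (hcell i hi).2.2.1
  · intro i hi
    simp only [mem_latNbrs, ← ha, hφ]; exact (hcell i hi).2.2.2.1
  · intro i hi B hB hy
    obtain ⟨hp, hlen⟩ := modelPath_spec k hk i hi
    have key : ∀ l z, IsModelApproach (6 + k) i (modelCell (6 + k) i) l z →
        (1 / 4 : ℝ) ^ l.length ≤ hitMeas latNbrs B (φ z) (φ (modelCell (6 + k) i)) := by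
      intro l
      induction l with
      | nil =>
        rintro z rfl
        rw [hitMeas_mem hy]; simp
      | cons w l ih =>
        rintro z ⟨h1, h2, h3, h4⟩
        have hz : φ z ∉ B := hB _ (by rw [← h0, hφ]; exact h2) fun j hj => by
          rw [mem_latNbrs, hφ]; exact h1 j hj
        rw [List.length_cons, pow_succ']
        exact (mul_le_mul_of_nonneg_left (ih w h4) (by norm_num)).trans
          (quarter_mul_le_hitMeas hz (mem_latNbrs.2 (by rw [hφ]; exact h3)))
    rw [← h0]
    exact (pow_le_pow_of_le_one (by norm_num) (by norm_num) hlen).trans (key _ _ hp)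
  · refine ⟨φ (3, 0), ?_, ?_, ?_, ?_⟩
    · rw [← h0, hφ]; simp [modelDist]
    · intro j hj hij
      exact (hcell j hj).2.2.2.2 (by rw [← hφ, hij, dist1_self])
    · intro z hz
      rw [← hψ z, mem_latNbrs, hφ] at hz
      obtain ⟨j, hj, h⟩ := modelCell_hole k hk _ hz
      exact ⟨j, hj, by rw [← hψ z, h]⟩
    · rw [mem_latNbrs, hφ]; simp [modelDist, modelCell]

end Plan

section Cluster

lemma mem_bdryF {A : Finset (Fin 2 → ℤ)} {z : Fin 2 → ℤ} :
    z ∈ bdryF latNbrs A ↔ z ∉ A ∧ ∃ w ∈ A, dist1 w z = 1 := by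
  simp only [bdryF, Finset.mem_sdiff, Finset.mem_biUnion, mem_latNbrs]
  tauto

lemma bdryF_nonempty {A : Finset (Fin 2 → ℤ)} (hA : A.Nonempty) :
    (bdryF latNbrs A).Nonempty := by
  obtain ⟨m, hm, hmax⟩ := Finset.exists_max_image A (fun z => z 0) hA
  refine ⟨![m 0 + 1, m 1], mem_bdryF.2 ⟨fun h => ?_, m, hm, by simp [dist1]⟩⟩
  have := hmax _ h
  simp at this

/-- The transition operator of the growth process. -/
noncomputable def stepOp (μ : Finset (Fin 2 → ℤ) → (Fin 2 → ℤ) → ℝ)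
    (φ : Finset (Fin 2 → ℤ) → ℝ) (A : Finset (Fin 2 → ℤ)) : ℝ :=
  ∑ y ∈ bdryF latNbrs A, μ (bdryF latNbrs A) y * φ (insert y A)

/-- The expected total of the rates `c n, c (n - 1), …, c 1` along `n` steps of the growth
process. -/
noncomputable def total (μ : Finset (Fin 2 → ℤ) → (Fin 2 → ℤ) → ℝ)
    (c : ℕ → Finset (Fin 2 → ℤ) → ℝ) : ℕ → Finset (Fin 2 → ℤ) → ℝ
  | 0, _ => 0
  | n + 1, A => c (n + 1) A + stepOp μ (total μ c n) A

variable {μ : Finset (Fin 2 → ℤ) → (Fin 2 → ℤ) → ℝ}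

lemma stepOp_add (φ ψ : Finset (Fin 2 → ℤ) → ℝ) (A : Finset (Fin 2 → ℤ)) :
    stepOp μ (fun B => φ B + ψ B) A = stepOp μ φ A + stepOp μ ψ A := by
  simp only [stepOp, mul_add, Finset.sum_add_distrib]

lemma stepOp_sum {ι : Type*} (K : Finset ι) (φ : ι → Finset (Fin 2 → ℤ) → ℝ)
    (A : Finset (Fin 2 → ℤ)) :
    stepOp μ (fun B => ∑ i ∈ K, φ i B) A = ∑ i ∈ K, stepOp μ (φ i) A := by
  simp only [stepOp, Finset.mul_sum]
  exact Finset.sum_comm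

lemma stepOp_mul (a : ℝ) (φ : Finset (Fin 2 → ℤ) → ℝ) (A : Finset (Fin 2 → ℤ)) :
    stepOp μ (fun B => a * φ B) A = a * stepOp μ φ A := by
  simp only [stepOp, Finset.mul_sum]
  exact Finset.sum_congr rfl fun _ _ => by ring

namespace IsHarmonicFromInfinity

variable (hμ : IsHarmonicFromInfinity μ)
include hμ

lemma stepOp_mono {φ ψ : Finset (Fin 2 → ℤ) → ℝ} {A : Finset (Fin 2 → ℤ)}
    (h : ∀ y ∈ bdryF latNbrs A, φ (insert y A) ≤ ψ (insert y A)) :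
    stepOp μ φ A ≤ stepOp μ ψ A :=
  Finset.sum_le_sum fun y hy => mul_le_mul_of_nonneg_left (h y hy) (hμ.nonneg hy)

lemma stepOp_nonneg {φ : Finset (Fin 2 → ℤ) → ℝ} (h : ∀ B, 0 ≤ φ B)
    (A : Finset (Fin 2 → ℤ)) : 0 ≤ stepOp μ φ A :=
  Finset.sum_nonneg fun _ hy => mul_nonneg (hμ.nonneg hy) (h _)

lemma stepOp_const (r : ℝ) {A : Finset (Fin 2 → ℤ)} (hA : A.Nonempty) :
    stepOp μ (fun _ => r) A = r := by
  rw [stepOp, ← Finset.sum_mul, hμ.sum_eq_one (bdryF_nonempty hA), one_mul]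

lemma total_nonneg {c : ℕ → Finset (Fin 2 → ℤ) → ℝ} (h : ∀ n B, 0 ≤ c n B) (n : ℕ)
    (A : Finset (Fin 2 → ℤ)) : 0 ≤ total μ c n A := by
  induction n generalizing A with
  | zero => exact le_rfl
  | succ n ih => exact add_nonneg (h _ _) (hμ.stepOp_nonneg ih A)

lemma total_mono {c d : ℕ → Finset (Fin 2 → ℤ) → ℝ} (h : ∀ n B, c n B ≤ d n B) (n : ℕ)
    (A : Finset (Fin 2 → ℤ)) : total μ c n A ≤ total μ d n A := by
  induction n generalizing A with
  | zero => exact le_rfl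
  | succ n ih => exact add_le_add (h _ _) (hμ.stepOp_mono fun y _ => ih _)

end IsHarmonicFromInfinity

lemma total_add (c d : ℕ → Finset (Fin 2 → ℤ) → ℝ) (n : ℕ) (A : Finset (Fin 2 → ℤ)) :
    total μ (fun n B => c n B + d n B) n A = total μ c n A + total μ d n A := by
  induction n generalizing A with
  | zero => simp [total]
  | succ n ih =>
    simp only [total]
    rw [show total μ (fun n B => c n B + d n B) n = fun B => total μ c n B + total μ d n B from
      funext ih, stepOp_add]
    ring

lemma total_sum {ι : Type*} (K : Finset ι) (c : ι → ℕ → Finset (Fin 2 → ℤ) → ℝ) (n : ℕ)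
    (A : Finset (Fin 2 → ℤ)) :
    total μ (fun n B => ∑ i ∈ K, c i n B) n A = ∑ i ∈ K, total μ (c i) n A := by
  induction n generalizing A with
  | zero => simp [total]
  | succ n ih =>
    simp only [total]
    rw [show total μ (fun n B => ∑ i ∈ K, c i n B) n = fun B => ∑ i ∈ K, total μ (c i) n B from
      funext ih, stepOp_sum, Finset.sum_add_distrib]

lemma total_mul (a : ℝ) (c : ℕ → Finset (Fin 2 → ℤ) → ℝ) (n : ℕ) (A : Finset (Fin 2 → ℤ)) :
    total μ (fun n B => a * c n B) n A = a * total μ c n A := by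
  induction n generalizing A with
  | zero => simp [total]
  | succ n ih =>
    simp only [total]
    rw [show total μ (fun n B => a * c n B) n = fun B => a * total μ c n B from
      funext ih, stepOp_mul]
    ring

end Cluster

section Zone

/-- The first `i` cells of a plan. -/
@[irreducible] def planCells (s : ℕ → Fin 2 → ℤ) (i : ℕ) : Finset (Fin 2 → ℤ) :=
  (Finset.range i).image s

/-- The sites relevant to a plan. -/
@[irreducible] noncomputable def planZone (x : Fin 2 → ℤ) (s : ℕ → Fin 2 → ℤ) :
    Finset (Fin 2 → ℤ) :=
  insert x (planCells s 14 ∪ (planCells s 14).biUnion latNbrs)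

/-- The cluster `A` has not come close to `x`. -/
def Far (x : Fin 2 → ℤ) (A : Finset (Fin 2 → ℤ)) : Prop := ∀ z ∈ A, 12 ≤ dist1 z x

/-- Harmonic measure from infinity of the boundary of `A` together with the zone of a plan. -/
noncomputable def zoneHarm (μ : Finset (Fin 2 → ℤ) → (Fin 2 → ℤ) → ℝ) (x : Fin 2 → ℤ)
    (s : ℕ → Fin 2 → ℤ) (A : Finset (Fin 2 → ℤ)) (w : Fin 2 → ℤ) : ℝ :=
  μ (bdryF latNbrs A ∪ planZone x s) w

open Classical in
/-- The probability that the next particle reaches `x` before the cluster and the rest of the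
zone, on the event that the cluster has not come close to `x`. -/
noncomputable def zoneRate (μ : Finset (Fin 2 → ℤ) → (Fin 2 → ℤ) → ℝ) (x : Fin 2 → ℤ)
    (s : ℕ → Fin 2 → ℤ) (A : Finset (Fin 2 → ℤ)) : ℝ :=
  if Far x A then zoneHarm μ x s A x else 0

/-- The probability that within `n` steps some particle visits `x` first in the zone. -/
noncomputable def visitProb (μ : Finset (Fin 2 → ℤ) → (Fin 2 → ℤ) → ℝ) (x : Fin 2 → ℤ)
    (s : ℕ → Fin 2 → ℤ) : ℕ → Finset (Fin 2 → ℤ) → ℝ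
  | 0, _ => 0
  | n + 1, A => ∑ y ∈ bdryF latNbrs A \ planZone x s,
      zoneHarm μ x s A y * visitProb μ x s n (insert y A) + zoneRate μ x s A

variable {μ : Finset (Fin 2 → ℤ) → (Fin 2 → ℤ) → ℝ} {x a : Fin 2 → ℤ} {s : ℕ → Fin 2 → ℤ}
  {A : Finset (Fin 2 → ℤ)}

lemma mem_planCells {z : Fin 2 → ℤ} {i : ℕ} : z ∈ planCells s i ↔ ∃ j < i, s j = z := by
  simp [planCells]

lemma planCells_succ (i : ℕ) : planCells s (i + 1) = insert (s i) (planCells s i) := by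
  rw [planCells, Finset.range_add_one, Finset.image_insert, planCells]

lemma planCells_mono {i j : ℕ} (h : i ≤ j) : planCells s i ⊆ planCells s j := by
  unfold planCells
  exact Finset.image_subset_image (Finset.range_subset_range.2 h)

lemma mem_planZone {z : Fin 2 → ℤ} : z ∈ planZone x s ↔
    z = x ∨ z ∈ planCells s 14 ∨ ∃ w ∈ planCells s 14, dist1 w z = 1 := by
  simp only [planZone, Finset.mem_insert, Finset.mem_union, Finset.mem_biUnion, mem_latNbrs]

lemma self_mem_planZone : x ∈ planZone x s := mem_planZone.2 (Or.inl rfl)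

lemma bdryF_union_planCells_union {i : ℕ} (hi : i ≤ 14) :
    bdryF latNbrs (A ∪ planCells s i) ∪ planZone x s = bdryF latNbrs A ∪ planZone x s := by
  have h := planCells_mono (s := s) hi
  ext z
  simp only [Finset.mem_union, mem_bdryF, mem_planZone]
  constructor
  · rintro (⟨h1, w, hw | hw, hz⟩ | h1)
    · exact Or.inl ⟨fun h => h1 (Or.inl h), w, hw, hz⟩
    · exact Or.inr (Or.inr (Or.inr ⟨w, h hw, hz⟩))
    · exact Or.inr h1
  · rintro (⟨h1, w, hw, hz⟩ | h1)
    · by_cases hzi : z ∈ planCells s i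
      · exact Or.inr (Or.inr (Or.inl (h hzi)))
      · exact Or.inl ⟨by tauto, w, Or.inl hw, hz⟩
    · exact Or.inr h1

lemma bdryF_union_planCells_sdiff {i : ℕ} (hi : i ≤ 14) :
    bdryF latNbrs (A ∪ planCells s i) \ planZone x s = bdryF latNbrs A \ planZone x s := by
  rw [← Finset.union_sdiff_right, bdryF_union_planCells_union hi, Finset.union_sdiff_right]

lemma zoneHarm_union {i : ℕ} (hi : i ≤ 14) (w : Fin 2 → ℤ) :
    zoneHarm μ x s (A ∪ planCells s i) w = zoneHarm μ x s A w := by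
  rw [zoneHarm, bdryF_union_planCells_union hi, zoneHarm]

lemma IsPlan.planZone_subset (hs : IsPlan x a s) (h : dist1 x a = 12) {z : Fin 2 → ℤ}
    (hz : z ∈ planZone x s) : dist1 z a ≤ 12 := by
  rcases mem_planZone.1 hz with rfl | hz | ⟨w, hw, hz⟩
  · exact h.le
  · obtain ⟨j, hj, rfl⟩ := mem_planCells.1 hz
    exact (hs.near j hj).trans (by norm_num)
  · obtain ⟨j, hj, rfl⟩ := mem_planCells.1 hw
    have := hs.near j hj
    have := dist1_triangle z (s j) a
    have := dist1_comm z (s j)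
    omega

lemma IsPlan.mem_bdryF (hs : IsPlan x a s) (ha : a ∈ A) (hA : Far x A) {i : ℕ} (hi : i < 14) :
    s i ∈ bdryF latNbrs (A ∪ planCells s i) := by
  rw [_root_.mem_bdryF]
  refine ⟨fun h => ?_, ?_⟩
  · rcases Finset.mem_union.1 h with h | h
    · exact absurd (hA _ h) (not_le.2 (hs.dist_lt i hi))
    · obtain ⟨j, hj, h⟩ := mem_planCells.1 h
      exact hs.ne i hi j hj h.symm
  · rcases hs.adj i hi with h | ⟨j, hj, h⟩
    · exact ⟨a, Finset.mem_union_left _ ha, mem_latNbrs.1 h⟩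
    · exact ⟨s j, Finset.mem_union_right _ (mem_planCells.2 ⟨j, hj, rfl⟩), mem_latNbrs.1 h⟩

lemma IsPlan.not_far_insert (hs : IsPlan x a s) {i : ℕ} (hi : i < 14) : ¬ Far x (insert (s i) A) :=
  fun h => absurd (h _ (Finset.mem_insert_self _ _)) (not_le.2 (hs.dist_lt i hi))

lemma Far.of_insert {y : Fin 2 → ℤ} (h : Far x (insert y A)) : Far x A :=
  fun z hz => h z (Finset.mem_insert_of_mem hz)

lemma visitProb_eq_zero (h : ¬ Far x A) (n : ℕ) : visitProb μ x s n A = 0 := by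
  induction n generalizing A with
  | zero => rfl
  | succ n ih =>
    rw [visitProb, zoneRate, if_neg h, add_zero]
    exact Finset.sum_eq_zero fun y _ => by rw [ih fun h' => h h'.of_insert, mul_zero]

namespace IsHarmonicFromInfinity

variable (hμ : IsHarmonicFromInfinity μ)
include hμ

lemma le_of_subset {B C : Finset (Fin 2 → ℤ)} (hBC : B ⊆ C) {y : Fin 2 → ℤ} (hy : y ∈ B) :
    μ C y ≤ μ B y := by
  refine le_trans ?_ (hμ.sum_mul_hitMeas_le hBC hy)
  refine le_trans ?_ (Finset.single_le_sum (f := fun w => μ C w * hitMeas latNbrs (↑B) w y)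
    (fun w hw => mul_nonneg (hμ.nonneg hw) (hitMeas_nonneg _ _ _)) (hBC hy))
  simp [hitMeas_mem (Finset.mem_coe.2 hy)]

lemma zoneHarm_nonneg {w : Fin 2 → ℤ} (hw : w ∈ bdryF latNbrs A ∪ planZone x s) :
    0 ≤ zoneHarm μ x s A w := hμ.nonneg hw

lemma zoneHarm_le {w : Fin 2 → ℤ} (hw : w ∈ bdryF latNbrs A) :
    zoneHarm μ x s A w ≤ μ (bdryF latNbrs A) w :=
  hμ.le_of_subset Finset.subset_union_left hw

lemma sum_zoneHarm : ∑ w ∈ bdryF latNbrs A \ planZone x s, zoneHarm μ x s A w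
    + ∑ w ∈ planZone x s, zoneHarm μ x s A w = 1 := by
  rw [← Finset.sum_union Finset.sdiff_disjoint, Finset.sdiff_union_self_eq_union]
  exact hμ.sum_eq_one ⟨x, Finset.mem_union_right _ self_mem_planZone⟩

lemma zoneRate_nonneg : 0 ≤ zoneRate μ x s A := by
  rw [zoneRate]
  split_ifs
  · exact hμ.zoneHarm_nonneg (Finset.mem_union_right _ self_mem_planZone)
  · exact le_rfl

lemma zoneRate_le : zoneRate μ x s A ≤ ∑ w ∈ planZone x s, zoneHarm μ x s A w := by
  have hn : ∀ w ∈ planZone x s, 0 ≤ zoneHarm μ x s A w := fun w hw =>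
    hμ.zoneHarm_nonneg (Finset.mem_union_right _ hw)
  rw [zoneRate]
  split_ifs
  · exact Finset.single_le_sum hn self_mem_planZone
  · exact Finset.sum_nonneg hn

lemma zoneHarm_sdiff_nonneg {y : Fin 2 → ℤ} (hy : y ∈ bdryF latNbrs A \ planZone x s) :
    0 ≤ zoneHarm μ x s A y :=
  hμ.zoneHarm_nonneg (Finset.mem_union_left _ (Finset.mem_sdiff.1 hy).1)

lemma visitProb_nonneg (n : ℕ) (A : Finset (Fin 2 → ℤ)) : 0 ≤ visitProb μ x s n A := by
  induction n generalizing A with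
  | zero => exact le_rfl
  | succ n ih =>
    exact add_nonneg (Finset.sum_nonneg fun y hy =>
      mul_nonneg (hμ.zoneHarm_sdiff_nonneg hy) (ih _)) hμ.zoneRate_nonneg

/-- Every cell of a plan is attached with probability comparable to that of visiting `x`. -/
lemma mul_zoneRate_le (hs : IsPlan x a s) (ha : a ∈ A) (hA : Far x A) {i : ℕ} (hi : i < 14) :
    (1 / 4) ^ 12 * zoneRate μ x s A
      ≤ μ (bdryF latNbrs (A ∪ planCells s i)) (s i) := by
  have hb := hs.mem_bdryF ha hA hi
  refine le_trans ?_ (hμ.sum_mul_hitMeas_le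
    (C := bdryF latNbrs (A ∪ planCells s i) ∪ planZone x s) Finset.subset_union_left hb)
  refine le_trans ?_ (Finset.single_le_sum
    (f := fun w => μ (bdryF latNbrs (A ∪ planCells s i) ∪ planZone x s) w *
      hitMeas latNbrs (↑(bdryF latNbrs (A ∪ planCells s i))) w (s i))
    (fun w hw => mul_nonneg (hμ.nonneg hw) (hitMeas_nonneg _ _ _))
    (Finset.mem_union_right _ (self_mem_planZone (x := x) (s := s))))
  have h1 : μ (bdryF latNbrs (A ∪ planCells s i) ∪ planZone x s) x = zoneRate μ x s A := by
    rw [zoneRate, if_pos hA, ← zoneHarm_union hi.le, zoneHarm]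
  simp only [h1]
  rw [mul_comm]
  refine mul_le_mul_of_nonneg_left (hs.approach i hi _ (fun z hz hzs h => ?_) hb)
    hμ.zoneRate_nonneg
  obtain ⟨-, w, hw, hwz⟩ := mem_bdryF.1 (Finset.mem_coe.1 h)
  rcases Finset.mem_union.1 hw with hw | hw
  · have := hA w hw
    have := dist1_triangle w z x
    omega
  · obtain ⟨j, hj, rfl⟩ := mem_planCells.1 hw
    exact hzs j hj (mem_latNbrs.2 hwz)

end IsHarmonicFromInfinity

end Zone

section Stages

/-- Attaching `y` to `A` encloses a single site. -/
def Creates (A : Finset (Fin 2 → ℤ)) (y : Fin 2 → ℤ) : Prop :=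
  ∃ o, o ∉ insert y A ∧ latNbrs o ⊆ insert y A ∧ y ∈ latNbrs o

open Classical in
/-- The probability of completing a plan by enclosing a site in the next step. -/
noncomputable def completeRate (μ : Finset (Fin 2 → ℤ) → (Fin 2 → ℤ) → ℝ)
    (s : ℕ → Fin 2 → ℤ) (A : Finset (Fin 2 → ℤ)) : ℝ :=
  ∑ y ∈ bdryF latNbrs A, μ (bdryF latNbrs A) y * if y = s 13 ∧ Creates A y then 1 else 0

/-- The expected number of completions of a plan. -/
noncomputable def completions (μ : Finset (Fin 2 → ℤ) → (Fin 2 → ℤ) → ℝ)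
    (s : ℕ → Fin 2 → ℤ) : ℕ → Finset (Fin 2 → ℤ) → ℝ :=
  total μ fun _ => completeRate μ s

variable {μ : Finset (Fin 2 → ℤ) → (Fin 2 → ℤ) → ℝ} {x a : Fin 2 → ℤ} {s : ℕ → Fin 2 → ℤ}
  {A : Finset (Fin 2 → ℤ)}

lemma IsPlan.creates (hs : IsPlan x a s) (hA : Far x A) : Creates (A ∪ planCells s 13) (s 13) := by
  obtain ⟨o, ho, hne, hsub, hmem⟩ := hs.hole
  refine ⟨o, ?_, ?_, hmem⟩
  · rw [← Finset.union_insert, ← planCells_succ, Finset.mem_union, mem_planCells]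
    rintro (h | ⟨j, hj, h⟩)
    · exact absurd (hA o h) (not_le.2 ho)
    · exact hne j hj h.symm
  · intro z hz
    obtain ⟨j, hj, rfl⟩ := hsub z hz
    rw [← Finset.union_insert, ← planCells_succ]
    exact Finset.mem_union_right _ (mem_planCells.2 ⟨j, hj, rfl⟩)

lemma pow_add_mul_le {u h : ℝ} (hu : 0 ≤ u) (hh : 0 ≤ h) (r : ℕ) :
    (u + h) ^ (r + 1) ≤ u ^ (r + 1) + (r + 1) * (h * (u + h) ^ r) := by
  induction r with
  | zero => simp
  | succ r ih =>
    have h1 : u ^ (r + 1) ≤ (u + h) ^ (r + 1) := pow_le_pow_left₀ hu (by linarith) _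
    have h2 := mul_le_mul_of_nonneg_left ih (add_nonneg hu hh)
    have h3 := mul_le_mul_of_nonneg_right h1 hh
    have e1 : (u + h) ^ (r + 1 + 1) = (u + h) * (u + h) ^ (r + 1) := by ring
    have e2 : (u + h) * (u ^ (r + 1) + (r + 1) * (h * (u + h) ^ r))
      = u ^ (r + 1 + 1) + u ^ (r + 1) * h + (r + 1) * (h * (u + h) ^ (r + 1)) := by ring
    push_cast
    nlinarith

lemma sum_pow_le {ι : Type*} (t : Finset ι) (q f : ι → ℝ) (hq : ∀ i ∈ t, 0 ≤ q i)
    (hf : ∀ i ∈ t, 0 ≤ f i) (hq1 : ∑ i ∈ t, q i ≤ 1) (r : ℕ) :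
    (∑ i ∈ t, q i * f i) ^ (r + 1) ≤ ∑ i ∈ t, q i * f i ^ (r + 1) := by
  have h := Real.pow_arith_mean_le_arith_mean_pow (Finset.insertNone t)
    (fun o => o.elim (1 - ∑ i ∈ t, q i) q) (fun o => o.elim 0 f)
    (by rintro (_ | i) hi <;> simp at hi ⊢ <;> [exact hq1; exact hq i hi])
    (by simp [Finset.sum_insertNone])
    (by rintro (_ | i) hi <;> simp at hi ⊢; exact hf i hi) (r + 1)
  simpa [Finset.sum_insertNone] using h

namespace IsHarmonicFromInfinity

variable (hμ : IsHarmonicFromInfinity μ)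
include hμ

lemma sum_zoneHarm_sdiff_add_zoneRate_le :
    ∑ w ∈ bdryF latNbrs A \ planZone x s, zoneHarm μ x s A w + zoneRate μ x s A ≤ 1 := by
  have := hμ.sum_zoneHarm (A := A) (x := x) (s := s)
  have := hμ.zoneRate_le (A := A) (x := x) (s := s)
  linarith

lemma completeRate_nonneg : 0 ≤ completeRate μ s A :=
  Finset.sum_nonneg fun y hy => mul_nonneg (hμ.nonneg hy) (by split_ifs <;> norm_num)

lemma completions_nonneg (n : ℕ) (A : Finset (Fin 2 → ℤ)) : 0 ≤ completions μ s n A :=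
  hμ.total_nonneg (fun _ _ => hμ.completeRate_nonneg) n A

/-- One stage of the plan, in an abstract form. -/
lemma visitProb_stage {U V : ℕ → Finset (Fin 2 → ℤ) → ℝ} {c : ℝ} (hc : 0 ≤ c) {r : ℕ}
    (hV0 : ∀ A, 0 ≤ V 0 A)
    (hV : ∀ n A, a ∈ A → ∑ y ∈ bdryF latNbrs A \ planZone x s,
      zoneHarm μ x s A y * V n (insert y A) + c * zoneRate μ x s A * U (n + 1) A ≤ V (n + 1) A)
    (hU : ∀ n A, a ∈ A → c ^ r * visitProb μ x s n A ^ r / (r.factorial : ℝ) ≤ U n A)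
    (n : ℕ) (A : Finset (Fin 2 → ℤ)) (ha : a ∈ A) :
    c ^ (r + 1) * visitProb μ x s n A ^ (r + 1) / ((r + 1).factorial : ℝ) ≤ V n A := by
  induction n generalizing A with
  | zero => simpa [visitProb] using hV0 A
  | succ n ih =>
    refine le_trans ?_ (hV n A ha)
    have hfac : (0 : ℝ) < ((r + 1).factorial : ℝ) := by positivity
    have hq : ∀ y ∈ bdryF latNbrs A \ planZone x s, 0 ≤ zoneHarm μ x s A y := fun y hy =>
      hμ.zoneHarm_sdiff_nonneg hy
    have hrate := hμ.zoneRate_nonneg (x := x) (s := s) (A := A)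
    have hsum := hμ.sum_zoneHarm_sdiff_add_zoneRate_le (x := x) (s := s) (A := A)
    set u := ∑ y ∈ bdryF latNbrs A \ planZone x s,
      zoneHarm μ x s A y * visitProb μ x s n (insert y A) with hu
    have hu0 : 0 ≤ u := Finset.sum_nonneg fun y hy =>
      mul_nonneg (hq y hy) (hμ.visitProb_nonneg n _)
    have hF : visitProb μ x s (n + 1) A = u + zoneRate μ x s A := rfl
    have h1 : c ^ (r + 1) * u ^ (r + 1) / ((r + 1).factorial : ℝ) ≤
        ∑ y ∈ bdryF latNbrs A \ planZone x s, zoneHarm μ x s A y * V n (insert y A) := by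
      have hj := sum_pow_le (bdryF latNbrs A \ planZone x s) (zoneHarm μ x s A)
        (fun y => visitProb μ x s n (insert y A)) hq (fun y _ => hμ.visitProb_nonneg n _)
        (by linarith) r
      have h2 : c ^ (r + 1) / ((r + 1).factorial : ℝ) * u ^ (r + 1) ≤
          c ^ (r + 1) / ((r + 1).factorial : ℝ) * ∑ y ∈ bdryF latNbrs A \ planZone x s,
            zoneHarm μ x s A y * visitProb μ x s n (insert y A) ^ (r + 1) :=
        mul_le_mul_of_nonneg_left hj (by positivity)
      calc c ^ (r + 1) * u ^ (r + 1) / ((r + 1).factorial : ℝ)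
          = c ^ (r + 1) / ((r + 1).factorial : ℝ) * u ^ (r + 1) := by ring
        _ ≤ _ := h2
        _ ≤ _ := by
          rw [Finset.mul_sum]
          refine Finset.sum_le_sum fun y hy => ?_
          have := mul_le_mul_of_nonneg_left (ih (insert y A) (Finset.mem_insert_of_mem ha))
            (hq y hy)
          refine le_trans (le_of_eq ?_) this
          ring
    have h2 : c * zoneRate μ x s A * (c ^ r * visitProb μ x s (n + 1) A ^ r / (r.factorial : ℝ))
        ≤ c * zoneRate μ x s A * U (n + 1) A :=
      mul_le_mul_of_nonneg_left (hU (n + 1) A ha) (mul_nonneg hc hrate)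
    rw [hF] at h2 ⊢
    have h3 := pow_add_mul_le hu0 hrate r
    have h4 := mul_le_mul_of_nonneg_left h3
      (show 0 ≤ c ^ (r + 1) / ((r + 1).factorial : ℝ) by positivity)
    have e1 : c * zoneRate μ x s A * (c ^ r * (u + zoneRate μ x s A) ^ r / (r.factorial : ℝ))
        = c ^ (r + 1) / ((r + 1).factorial : ℝ) *
          ((r + 1) * (zoneRate μ x s A * (u + zoneRate μ x s A) ^ r)) := by
      rw [Nat.factorial_succ]
      have : (r.factorial : ℝ) ≠ 0 := by positivity
      push_cast
      field_simp
      ring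
    calc _ = c ^ (r + 1) / ((r + 1).factorial : ℝ) * (u + zoneRate μ x s A) ^ (r + 1) := by ring
      _ ≤ _ := h4
      _ = c ^ (r + 1) * u ^ (r + 1) / ((r + 1).factorial : ℝ) + c ^ (r + 1) /
          ((r + 1).factorial : ℝ) * ((r + 1) * (zoneRate μ x s A *
            (u + zoneRate μ x s A) ^ r)) := by ring
      _ ≤ _ := add_le_add h1 (e1 ▸ h2)

/-- Effect of one step of the process on a partially executed plan. -/
lemma stepOp_planCells_ge (hs : IsPlan x a s) {i : ℕ} (hi : i < 14)
    {φ : (Fin 2 → ℤ) → ℝ} (hφ : ∀ y, 0 ≤ φ y) (ha : a ∈ A) :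
    ∑ y ∈ bdryF latNbrs A \ planZone x s, zoneHarm μ x s A y * φ y
      + (1 / 4) ^ 12 * zoneRate μ x s A * φ (s i)
      ≤ ∑ y ∈ bdryF latNbrs (A ∪ planCells s i),
        μ (bdryF latNbrs (A ∪ planCells s i)) y * φ y := by
  have hsub : bdryF latNbrs A \ planZone x s ⊆ bdryF latNbrs (A ∪ planCells s i) := by
    rw [← bdryF_union_planCells_sdiff hi.le]; exact Finset.sdiff_subset
  have h1 : ∑ y ∈ bdryF latNbrs A \ planZone x s, zoneHarm μ x s A y * φ y ≤
      ∑ y ∈ bdryF latNbrs A \ planZone x s,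
        μ (bdryF latNbrs (A ∪ planCells s i)) y * φ y := by
    refine Finset.sum_le_sum fun y hy => mul_le_mul_of_nonneg_right ?_ (hφ y)
    rw [← zoneHarm_union hi.le]
    exact hμ.zoneHarm_le (hsub hy)
  have hnn : ∀ y ∈ bdryF latNbrs (A ∪ planCells s i),
      0 ≤ μ (bdryF latNbrs (A ∪ planCells s i)) y * φ y := fun y hy =>
    mul_nonneg (hμ.nonneg hy) (hφ y)
  by_cases hA : Far x A
  · have hb := hs.mem_bdryF ha hA hi
    have hz : s i ∉ bdryF latNbrs A \ planZone x s := fun h =>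
      (Finset.mem_sdiff.1 h).2 (mem_planZone.2 (Or.inr (Or.inl (mem_planCells.2 ⟨i, hi, rfl⟩))))
    have h2 := mul_le_mul_of_nonneg_right (hμ.mul_zoneRate_le hs ha hA hi) (hφ (s i))
    have h3 := Finset.sum_le_sum_of_subset_of_nonneg (Finset.insert_subset hb hsub)
      fun y hy _ => hnn y hy
    rw [Finset.sum_insert hz] at h3
    linarith
  · rw [zoneRate, if_neg hA, mul_zero, zero_mul, add_zero]
    exact h1.trans (Finset.sum_le_sum_of_subset_of_nonneg hsub fun y hy _ => hnn y hy)

/-- With `r + 1` cells of the plan left to be added, the expected number of completions is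
bounded below in terms of the probability of visiting `x`. -/
lemma completions_ge (hs : IsPlan x a s) (r i : ℕ) (hri : r + 1 + i = 14) (n : ℕ)
    (A : Finset (Fin 2 → ℤ)) (ha : a ∈ A) :
    ((1 / 4 : ℝ) ^ 12) ^ (r + 1) * visitProb μ x s n A ^ (r + 1) / ((r + 1).factorial : ℝ)
      ≤ completions μ s (n + (r + 1)) (A ∪ planCells s i) := by
  induction r generalizing i n A with
  | zero =>
    obtain rfl : i = 13 := by omega
    refine hμ.visitProb_stage (U := fun _ _ => 1)
      (V := fun n A => completions μ s (n + 1) (A ∪ planCells s 13)) (by positivity)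
      (fun A => hμ.completions_nonneg _ _) ?_ (by simp) n A ha
    intro n A ha
    classical
    have h := hμ.stepOp_planCells_ge hs (i := 13) (by norm_num) (φ := fun y =>
      (if y = s 13 ∧ Creates (A ∪ planCells s 13) y then 1 else 0) +
        completions μ s (n + 1) (insert y (A ∪ planCells s 13)))
      (fun y => add_nonneg (by split_ifs <;> norm_num) (hμ.completions_nonneg _ _)) ha
    have e : completions μ s (n + 1 + 1) (A ∪ planCells s 13) =
        ∑ y ∈ bdryF latNbrs (A ∪ planCells s 13), μ (bdryF latNbrs (A ∪ planCells s 13)) y *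
          ((if y = s 13 ∧ Creates (A ∪ planCells s 13) y then 1 else 0) +
            completions μ s (n + 1) (insert y (A ∪ planCells s 13))) := by
      simp only [mul_add, Finset.sum_add_distrib]
      rfl
    rw [e]
    refine le_trans (add_le_add (Finset.sum_le_sum fun y hy => mul_le_mul_of_nonneg_left ?_
      (hμ.zoneHarm_sdiff_nonneg hy)) ?_) h
    · rw [Finset.insert_union]
      exact le_add_of_nonneg_left (by split_ifs <;> norm_num)
    · by_cases hA : Far x A
      · refine mul_le_mul_of_nonneg_left ?_ (mul_nonneg (by positivity) hμ.zoneRate_nonneg)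
        rw [if_pos ⟨rfl, hs.creates hA⟩]
        exact le_add_of_nonneg_right (hμ.completions_nonneg _ _)
      · rw [zoneRate, if_neg hA]; simp
  | succ r ih =>
    refine hμ.visitProb_stage (r := r + 1)
      (U := fun n A => completions μ s (n + (r + 1)) (A ∪ planCells s (i + 1)))
      (V := fun n A => completions μ s (n + (r + 1 + 1)) (A ∪ planCells s i)) (by positivity)
      (fun A => hμ.completions_nonneg _ _) ?_ (ih (i + 1) (by omega)) n A ha
    intro n A ha
    have h := hμ.stepOp_planCells_ge hs (i := i) (by omega) (φ := fun y =>
        completions μ s (n + (r + 1 + 1)) (insert y (A ∪ planCells s i)))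
      (fun y => hμ.completions_nonneg _ _) ha
    simp only [Finset.insert_union]
    rw [planCells_succ, Finset.union_insert, show n + 1 + (r + 1) = n + (r + 1 + 1) by ring]
    refine h.trans ?_
    rw [show n + 1 + (r + 1 + 1) = n + (r + 1 + 1) + 1 by ring]
    exact le_add_of_nonneg_left hμ.completeRate_nonneg

end IsHarmonicFromInfinity

end Stages

section Creation

/-- A plan for every admissible pair of a starting point and a cluster point. -/
noncomputable def planOf (κ : (Fin 2 → ℤ) × (Fin 2 → ℤ)) : ℕ → Fin 2 → ℤ :=
  if h : dist1 κ.1 κ.2 = 12 then Classical.choose (exists_isPlan h) else fun _ => κ.2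

lemma isPlan_planOf {κ : (Fin 2 → ℤ) × (Fin 2 → ℤ)} (h : dist1 κ.1 κ.2 = 12) :
    IsPlan κ.1 κ.2 (planOf κ) := by
  rw [planOf, dif_pos h]
  exact Classical.choose_spec (exists_isPlan h)

/-- A bound for the number of plans near a given site. -/
@[irreducible] def planBound : ℕ := 49 ^ 2 * 25 ^ 2

/-- `K` consists of pairs at distance `12`. -/
def IsPairs (K : Finset ((Fin 2 → ℤ) × (Fin 2 → ℤ))) : Prop := ∀ κ ∈ K, dist1 κ.1 κ.2 = 12

lemma card_near_le {K : Finset ((Fin 2 → ℤ) × (Fin 2 → ℤ))} (hK : IsPairs K) (y : Fin 2 → ℤ) :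
    (K.filter fun κ => dist1 y κ.2 ≤ 12).card ≤ planBound := by
  have hsub : (K.filter fun κ => dist1 y κ.2 ≤ 12) ⊆ ball1 y 24 ×ˢ ball1 y 12 := by
    intro κ hκ
    simp only [Finset.mem_filter, Finset.mem_product, mem_ball1] at hκ ⊢
    have := hK κ hκ.1
    have := dist1_triangle κ.1 κ.2 y
    have := dist1_comm y κ.2
    omega
  refine (Finset.card_le_card hsub).trans ?_
  rw [Finset.card_product, show planBound = (2 * 24 + 1) ^ 2 * (2 * 12 + 1) ^ 2 by
    norm_num [planBound]]
  exact Nat.mul_le_mul (card_ball1_le y 24) (card_ball1_le y 12)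

variable {μ : Finset (Fin 2 → ℤ) → (Fin 2 → ℤ) → ℝ} {x a : Fin 2 → ℤ} {s : ℕ → Fin 2 → ℤ}
  {A : Finset (Fin 2 → ℤ)}

open Classical in
/-- The rate of visits to `x`, restricted to times at which `Q` holds. -/
noncomputable def restrictedRate (μ : Finset (Fin 2 → ℤ) → (Fin 2 → ℤ) → ℝ)
    (x a : Fin 2 → ℤ) (s : ℕ → Fin 2 → ℤ) (Q : ℝ → Prop) (n : ℕ) (A : Finset (Fin 2 → ℤ)) : ℝ :=
  if a ∈ A ∧ Q (visitProb μ x s n A) then zoneRate μ x s A else 0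

/-- The expected number of first visits to `x`, restricted to times at which `Q` holds. -/
noncomputable def visits (μ : Finset (Fin 2 → ℤ) → (Fin 2 → ℤ) → ℝ)
    (x a : Fin 2 → ℤ) (s : ℕ → Fin 2 → ℤ) (Q : ℝ → Prop) : ℕ → Finset (Fin 2 → ℤ) → ℝ :=
  total μ (restrictedRate μ x a s Q)

open Classical in
/-- The probability of enclosing a site within `n` steps. -/
noncomputable def createProb (μ : Finset (Fin 2 → ℤ) → (Fin 2 → ℤ) → ℝ) :
    ℕ → Finset (Fin 2 → ℤ) → ℝ
  | 0, _ => 0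
  | n + 1, A => ∑ y ∈ bdryF latNbrs A, μ (bdryF latNbrs A) y *
      if Creates A y then 1 else createProb μ n (insert y A)

open Classical in
/-- The probability of enclosing a site in the next step. -/
noncomputable def createRate (μ : Finset (Fin 2 → ℤ) → (Fin 2 → ℤ) → ℝ)
    (A : Finset (Fin 2 → ℤ)) : ℝ :=
  ∑ y ∈ bdryF latNbrs A, μ (bdryF latNbrs A) y * if Creates A y then 1 else 0

lemma visits_eq_zero (h : ¬ Far x A) (Q : ℝ → Prop) (n : ℕ) : visits μ x a s Q n A = 0 := by
  induction n generalizing A with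
  | zero => rfl
  | succ n ih =>
    have h1 : restrictedRate μ x a s Q (n + 1) A = 0 := by
      rw [restrictedRate, zoneRate, if_neg h, ite_self]
    have h2 : stepOp μ (visits μ x a s Q n) A = 0 :=
      Finset.sum_eq_zero fun y _ => by rw [ih fun h' => h h'.of_insert, mul_zero]
    change restrictedRate μ x a s Q (n + 1) A + stepOp μ (visits μ x a s Q n) A = 0
    rw [h1, h2, add_zero]

lemma visits_succ (Q : ℝ → Prop) (n : ℕ) (A : Finset (Fin 2 → ℤ)) :
    visits μ x a s Q (n + 1) A
      = restrictedRate μ x a s Q (n + 1) A + stepOp μ (visits μ x a s Q n) A := rfl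

lemma completions_succ (n : ℕ) (A : Finset (Fin 2 → ℤ)) :
    completions μ s (n + 1) A = completeRate μ s A + stepOp μ (completions μ s n) A := rfl

lemma visits_add_not (Q : ℝ → Prop) (n : ℕ) (A : Finset (Fin 2 → ℤ)) :
    visits μ x a s (fun _ => True) n A
      = visits μ x a s Q n A + visits μ x a s (fun t => ¬ Q t) n A := by
  rw [visits, visits, visits, ← total_add]
  congr 1
  ext n B
  simp only [restrictedRate]
  by_cases h : a ∈ B <;> by_cases hQ : Q (visitProb μ x s n B) <;> simp [h, hQ]

namespace IsHarmonicFromInfinity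

variable (hμ : IsHarmonicFromInfinity μ)
include hμ

lemma sum_bdryF_le_one (A : Finset (Fin 2 → ℤ)) :
    ∑ y ∈ bdryF latNbrs A, μ (bdryF latNbrs A) y ≤ 1 := by
  rcases (bdryF latNbrs A).eq_empty_or_nonempty with h | h
  · rw [h, Finset.sum_empty]; exact zero_le_one
  · exact (hμ.sum_eq_one h).le

lemma createProb_nonneg (n : ℕ) (A : Finset (Fin 2 → ℤ)) : 0 ≤ createProb μ n A := by
  induction n generalizing A with
  | zero => exact le_rfl
  | succ n ih =>
    refine Finset.sum_nonneg fun y hy => mul_nonneg (hμ.nonneg hy) ?_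
    split_ifs
    exacts [zero_le_one, ih _]

lemma createProb_le_one (n : ℕ) (A : Finset (Fin 2 → ℤ)) : createProb μ n A ≤ 1 := by
  induction n generalizing A with
  | zero => exact zero_le_one
  | succ n ih =>
    refine le_trans (Finset.sum_le_sum fun y hy => mul_le_of_le_one_right (hμ.nonneg hy) ?_)
      (hμ.sum_bdryF_le_one A)
    split_ifs
    exacts [le_rfl, ih _]

lemma total_createRate_le (n : ℕ) (A : Finset (Fin 2 → ℤ)) :
    total μ (fun _ => createRate μ) n A ≤ n * createProb μ n A := by
  induction n generalizing A with
  | zero => simp [total]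
  | succ n ih =>
    rw [total, createRate, stepOp, createProb, ← Finset.sum_add_distrib, Finset.mul_sum]
    refine Finset.sum_le_sum fun y hy => ?_
    have h1 := ih (insert y A)
    have h2 := hμ.createProb_le_one n (insert y A)
    have h3 := hμ.createProb_nonneg n (insert y A)
    have hn : (0 : ℝ) ≤ n := Nat.cast_nonneg n
    rw [← mul_add, mul_left_comm]
    refine mul_le_mul_of_nonneg_left ?_ (hμ.nonneg hy)
    push_cast
    split_ifs <;> nlinarith

lemma sum_completions_le {K : Finset ((Fin 2 → ℤ) × (Fin 2 → ℤ))} (hK : IsPairs K) (n : ℕ)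
    (A : Finset (Fin 2 → ℤ)) :
    ∑ κ ∈ K, completions μ (planOf κ) n A ≤ planBound * total μ (fun _ => createRate μ) n A := by
  rw [← total_mul]
  simp only [completions]
  rw [← total_sum]
  refine hμ.total_mono (fun _ B => ?_) n A
  simp only [completeRate, createRate]
  rw [Finset.sum_comm, Finset.mul_sum]
  refine Finset.sum_le_sum fun y hy => ?_
  rw [← Finset.mul_sum, mul_left_comm]
  refine mul_le_mul_of_nonneg_left ?_ (hμ.nonneg hy)
  split_ifs with hc
  · simp only [hc, and_true, mul_one]
    rw [Finset.sum_boole]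
    refine Nat.cast_le.2 ((Finset.card_le_card fun κ hκ => ?_).trans (card_near_le hK y))
    obtain ⟨h1, h2⟩ := Finset.mem_filter.1 hκ
    refine Finset.mem_filter.2 ⟨h1, ?_⟩
    rw [h2]
    exact ((isPlan_planOf (hK κ h1)).near 13 (by norm_num)).trans (by norm_num)
  · simp [hc]

/-- First visits at times when the visit probability is not small lead to completions. -/
lemma mul_visits_le_completions (hs : IsPlan x a s) {t : ℝ} (ht : 0 ≤ t) (n : ℕ)
    (A : Finset (Fin 2 → ℤ)) :
    (1 / 4 : ℝ) ^ 12 * (((1 / 4 : ℝ) ^ 12) ^ 13 * t ^ 13 / (Nat.factorial 13 : ℝ)) *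
      visits μ x a s (fun f => ¬ f ≤ t) n A ≤ completions μ s (n + 14) A := by
  set b : ℝ := ((1 / 4 : ℝ) ^ 12) ^ 13 * t ^ 13 / (Nat.factorial 13 : ℝ) with hb
  have hb0 : 0 ≤ b := by positivity
  have hq0 : (0 : ℝ) ≤ (1 / 4 : ℝ) ^ 12 := by positivity
  clear_value b
  induction n generalizing A with
  | zero => simpa [visits, total] using hμ.completions_nonneg _ _
  | succ n ih =>
    rw [visits_succ, show n + 1 + 14 = n + 14 + 1 by ring, completions_succ, mul_add, ← stepOp_mul]
    have hr := hμ.completeRate_nonneg (s := s) (A := A)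
    by_cases h : a ∈ A ∧ ¬ visitProb μ x s (n + 1) A ≤ t
    · obtain ⟨ha, hf⟩ := h
      have hA : Far x A := by
        by_contra hA
        exact hf (by rw [visitProb_eq_zero hA]; exact ht)
      rw [restrictedRate, if_pos ⟨ha, hf⟩]
      have h0 : planCells s 0 = ∅ := by simp [planCells]
      have h1 : planCells s 1 = {s 0} := by simp [planCells]
      have hmem := hs.mem_bdryF ha hA (i := 0) (by norm_num)
      have hrate := hμ.mul_zoneRate_le hs ha hA (i := 0) (by norm_num)
      rw [h0, Finset.union_empty] at hmem hrate
      have hc := hμ.completions_ge hs 12 1 (by norm_num) (n + 1) A ha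
      rw [h1, Finset.union_comm, ← Finset.insert_eq] at hc
      have hbc : b ≤ completions μ s (n + 14) (insert (s 0) A) := by
        refine le_trans ?_ hc
        rw [hb]
        gcongr
        exact (not_le.1 hf).le
      have key : stepOp μ (fun B => (1 / 4 : ℝ) ^ 12 * b * visits μ x a s (fun f => ¬ f ≤ t) n B) A
          + μ (bdryF latNbrs A) (s 0) * b ≤ stepOp μ (completions μ s (n + 14)) A := by
        have e : μ (bdryF latNbrs A) (s 0) * b = ∑ y ∈ bdryF latNbrs A,
            μ (bdryF latNbrs A) y * if y = s 0 then b else 0 := by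
          simp [hmem]
        rw [e, stepOp, ← Finset.sum_add_distrib]
        refine Finset.sum_le_sum fun y hy => ?_
        rw [← mul_add]
        refine mul_le_mul_of_nonneg_left ?_ (hμ.nonneg hy)
        split_ifs with hy0
        · rw [hy0, visits_eq_zero (hs.not_far_insert (by norm_num)), mul_zero, zero_add]
          exact hbc
        · rw [add_zero]; exact ih _
      have := mul_le_mul_of_nonneg_right hrate hb0
      linarith
    · rw [restrictedRate, if_neg h, mul_zero, zero_add]
      have := hμ.stepOp_mono (A := A)
        (φ := fun B => (1 / 4 : ℝ) ^ 12 * b * visits μ x a s (fun f => ¬ f ≤ t) n B)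
        (ψ := completions μ s (n + 14)) fun y _ => ih (insert y A)
      linarith

end IsHarmonicFromInfinity

end Creation

section LowerBound

variable {μ : Finset (Fin 2 → ℤ) → (Fin 2 → ℤ) → ℝ} {x a : Fin 2 → ℤ} {s : ℕ → Fin 2 → ℤ}
  {A : Finset (Fin 2 → ℤ)} {K : Finset ((Fin 2 → ℤ) × (Fin 2 → ℤ))}

/-- Started within distance `d` of a cluster point `a`, the walk has a definite chance of hitting
the boundary of the cluster within distance `d` of `a`. -/
lemma le_sum_hitMeas_near (ha : a ∈ A) (d : ℕ) (w : Fin 2 → ℤ) (hw : w ∉ A)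
    (hd : dist1 w a ≤ d) :
    (1 / 4 : ℝ) ^ d ≤ ∑ y ∈ (bdryF latNbrs A).filter (fun y => dist1 y a ≤ d),
      hitMeas latNbrs (↑(bdryF latNbrs A)) w y := by
  have hbd : ∀ d w, w ∈ bdryF latNbrs A → dist1 w a ≤ d →
      (1 / 4 : ℝ) ^ d ≤ ∑ y ∈ (bdryF latNbrs A).filter (fun y => dist1 y a ≤ d),
        hitMeas latNbrs (↑(bdryF latNbrs A)) w y := by
    intro d w hwb hd
    refine le_trans (pow_le_one₀ (by norm_num) (by norm_num)) ?_
    refine le_trans ?_ (Finset.single_le_sum (fun y _ => hitMeas_nonneg _ w y)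
      (Finset.mem_filter.2 ⟨hwb, hd⟩))
    rw [hitMeas_mem (Finset.mem_coe.2 hwb), if_pos rfl]
  induction d generalizing w with
  | zero =>
    obtain rfl := eq_of_dist1_eq_zero (Nat.le_zero.1 hd)
    exact absurd ha hw
  | succ d ih =>
    by_cases hwb : w ∈ bdryF latNbrs A
    · exact hbd (d + 1) w hwb hd
    · obtain ⟨z, hz, hza⟩ : ∃ z ∈ latNbrs w, dist1 z a ≤ d := by
        rcases Nat.eq_zero_or_pos (dist1 w a) with h0 | h0
        · exact absurd (eq_of_dist1_eq_zero h0 ▸ ha) hw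
        · obtain ⟨z, hz, h⟩ := exists_closer (w := w) (a := a) (d := dist1 w a - 1) (by omega)
          exact ⟨z, hz, by omega⟩
      have hzA : z ∉ A := fun h =>
        hwb (mem_bdryF.2 ⟨hw, z, h, mem_latNbrs.1 (mem_latNbrs_comm.1 hz)⟩)
      have h1 := ih z hzA hza
      rw [pow_succ']
      refine (mul_le_mul_of_nonneg_left h1 (by norm_num)).trans ?_
      rw [Finset.mul_sum]
      refine (Finset.sum_le_sum fun y _ =>
        quarter_mul_le_hitMeas (mt Finset.mem_coe.1 hwb) hz).trans ?_
      refine Finset.sum_le_sum_of_subset_of_nonneg (fun y hy => ?_)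
        fun y _ _ => hitMeas_nonneg _ _ _
      simp only [Finset.mem_filter] at hy ⊢
      exact ⟨hy.1, by omega⟩

namespace IsHarmonicFromInfinity

variable (hμ : IsHarmonicFromInfinity μ)
include hμ

lemma mul_sum_zoneHarm_le (hs : IsPlan x a s) (hxa : dist1 x a = 12) (ha : a ∈ A) :
    (1 / 4) ^ 12 * ∑ w ∈ planZone x s, zoneHarm μ x s A w
      ≤ ∑ y ∈ (bdryF latNbrs A).filter (fun y => dist1 y a ≤ 12), μ (bdryF latNbrs A) y := by
  have hz : ∀ w ∈ planZone x s, 0 ≤ zoneHarm μ x s A w := fun w hw =>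
    hμ.zoneHarm_nonneg (Finset.mem_union_right _ hw)
  have h1 : ∀ y ∈ (bdryF latNbrs A).filter (fun y => dist1 y a ≤ 12),
      ∑ w ∈ planZone x s, zoneHarm μ x s A w * hitMeas latNbrs (↑(bdryF latNbrs A)) w y
        ≤ μ (bdryF latNbrs A) y := fun y hy =>
    (Finset.sum_le_sum_of_subset_of_nonneg Finset.subset_union_right fun w hw _ =>
      mul_nonneg (hμ.zoneHarm_nonneg hw) (hitMeas_nonneg _ _ _)).trans
      (hμ.sum_mul_hitMeas_le (C := bdryF latNbrs A ∪ planZone x s) Finset.subset_union_left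
        (Finset.mem_of_mem_filter y hy))
  refine le_trans ?_ (Finset.sum_le_sum h1)
  rw [Finset.sum_comm, Finset.mul_sum]
  refine Finset.sum_le_sum fun w hw => ?_
  rw [← Finset.mul_sum, mul_comm]
  by_cases hwA : w ∈ A
  · have : zoneHarm μ x s A w = 0 := by
      refine hμ.eq_zero_of_barrier (S := ↑A) A.finite_toSet (fun u hu huA z hz hzA => ?_)
        (Finset.mem_union_right _ hw) hwA
      exact hu (Finset.mem_union_left _ (mem_bdryF.2
        ⟨huA, z, hzA, mem_latNbrs.1 (mem_latNbrs_comm.1 hz)⟩))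
    rw [this, zero_mul, zero_mul]
  · exact mul_le_mul_of_nonneg_left
      (le_sum_hitMeas_near ha 12 w hwA (hs.planZone_subset hxa hw)) (hz w hw)

/-- The plans attached to a cluster have uniformly bounded total harmonic measure. -/
lemma sum_sum_zoneHarm_le (hK : IsPairs K) (A : Finset (Fin 2 → ℤ)) :
    ∑ κ ∈ K.filter (fun κ => κ.2 ∈ A), ∑ w ∈ planZone κ.1 (planOf κ),
      zoneHarm μ κ.1 (planOf κ) A w ≤ 4 ^ 12 * planBound := by
  have h1 : (1 / 4) ^ 12 * ∑ κ ∈ K.filter (fun κ => κ.2 ∈ A), ∑ w ∈ planZone κ.1 (planOf κ),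
      zoneHarm μ κ.1 (planOf κ) A w ≤ planBound := by
    rw [Finset.mul_sum]
    refine (Finset.sum_le_sum fun κ hκ => ?_).trans (b := ∑ κ ∈ K.filter (fun κ => κ.2 ∈ A),
      ∑ y ∈ bdryF latNbrs A, if dist1 y κ.2 ≤ 12 then μ (bdryF latNbrs A) y else 0) ?_
    · rw [Finset.mem_filter] at hκ
      rw [← Finset.sum_filter]
      exact hμ.mul_sum_zoneHarm_le (isPlan_planOf (hK κ hκ.1)) (hK κ hκ.1) hκ.2
    · rw [Finset.sum_comm]
      have h2 : ∀ y ∈ bdryF latNbrs A, (∑ κ ∈ K.filter (fun κ => κ.2 ∈ A),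
          if dist1 y κ.2 ≤ 12 then μ (bdryF latNbrs A) y else 0)
          ≤ planBound * μ (bdryF latNbrs A) y := fun y hy => by
        rw [← Finset.sum_filter, Finset.sum_const, nsmul_eq_mul]
        refine mul_le_mul_of_nonneg_right (Nat.cast_le.2 ?_) (hμ.nonneg hy)
        exact (Finset.card_le_card (Finset.filter_subset_filter _
          (Finset.filter_subset _ _))).trans (card_near_le hK y)
      refine (Finset.sum_le_sum h2).trans ?_
      rw [← Finset.mul_sum]
      exact mul_le_of_le_one_right (Nat.cast_nonneg _) (hμ.sum_bdryF_le_one A)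
  rw [one_div, inv_pow, inv_mul_le_iff₀ (by positivity)] at h1
  exact h1

lemma restrictedRate_add_stepOp_min_le {t : ℝ} (ht : 0 ≤ t) (ha : a ∈ A) (n : ℕ) :
    restrictedRate μ x a s (fun f => f ≤ t) (n + 1) A
      + stepOp μ (fun B => min (visitProb μ x s n B) t) A
      ≤ min (visitProb μ x s (n + 1) A) t + t * ∑ w ∈ planZone x s, zoneHarm μ x s A w := by
  have hz : 0 ≤ ∑ w ∈ planZone x s, zoneHarm μ x s A w :=
    Finset.sum_nonneg fun w hw => hμ.zoneHarm_nonneg (Finset.mem_union_right _ hw)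
  have hmass := hμ.sum_zoneHarm (x := x) (s := s) (A := A)
  have hm := hμ.sum_bdryF_le_one A
  by_cases h : visitProb μ x s (n + 1) A ≤ t
  · rw [restrictedRate, if_pos ⟨ha, h⟩, min_eq_left h]
    have h1 : stepOp μ (fun B => min (visitProb μ x s n B) t) A ≤
        ∑ y ∈ bdryF latNbrs A \ planZone x s,
          zoneHarm μ x s A y * visitProb μ x s n (insert y A)
        + (∑ y ∈ bdryF latNbrs A, μ (bdryF latNbrs A) y * t
          - ∑ y ∈ bdryF latNbrs A \ planZone x s, zoneHarm μ x s A y * t) := by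
      rw [stepOp, Finset.sdiff_eq_filter, Finset.sum_filter, Finset.sum_filter,
        ← Finset.sum_sub_distrib, ← Finset.sum_add_distrib]
      refine Finset.sum_le_sum fun y hy => ?_
      have h2 := hμ.zoneHarm_le (x := x) (s := s) hy
      have h3 := hμ.zoneHarm_nonneg (x := x) (s := s) (Finset.mem_union_left _ hy)
      have h4 := min_le_left (visitProb μ x s n (insert y A)) t
      have h5 := min_le_right (visitProb μ x s n (insert y A)) t
      have h6 := hμ.nonneg hy
      split_ifs <;> nlinarith
    have h2 : visitProb μ x s (n + 1) A = ∑ y ∈ bdryF latNbrs A \ planZone x s,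
        zoneHarm μ x s A y * visitProb μ x s n (insert y A) + zoneRate μ x s A := rfl
    rw [← Finset.sum_mul, ← Finset.sum_mul] at h1
    rw [h2]
    nlinarith
  · rw [restrictedRate, if_neg fun h' => h h'.2, min_eq_right (not_le.1 h).le, zero_add]
    have h1 : stepOp μ (fun B => min (visitProb μ x s n B) t) A ≤
        ∑ y ∈ bdryF latNbrs A, μ (bdryF latNbrs A) y * t :=
      Finset.sum_le_sum fun y hy => mul_le_mul_of_nonneg_left (min_le_right _ _) (hμ.nonneg hy)
    rw [← Finset.sum_mul] at h1
    nlinarith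

/-- First visits at times when the visit probability is small are rare. -/
lemma sum_visits_le (hK : IsPairs K) {t : ℝ} (ht : 0 ≤ t) (n : ℕ) (A : Finset (Fin 2 → ℤ)) :
    ∑ κ ∈ K, visits μ κ.1 κ.2 (planOf κ) (fun f => f ≤ t) n A
      ≤ ∑ κ ∈ K.filter (fun κ => κ.2 ∈ A), min (visitProb μ κ.1 (planOf κ) n A) t
        + t * (planBound + 4 ^ 12 * planBound) * n := by
  induction n generalizing A with
  | zero =>
    simp only [visits, total, Finset.sum_const_zero, CharP.cast_eq_zero, mul_zero, add_zero]
    exact Finset.sum_nonneg fun κ _ => le_min le_rfl ht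
  | succ n ih =>
    have hmin : ∀ (κ : (Fin 2 → ℤ) × (Fin 2 → ℤ)) (B : Finset (Fin 2 → ℤ)),
        0 ≤ min (visitProb μ κ.1 (planOf κ) n B) t := fun κ B =>
      le_min (hμ.visitProb_nonneg n B) ht
    have hM : (0 : ℝ) ≤ planBound := Nat.cast_nonneg _
    have h1 : ∀ y ∈ bdryF latNbrs A,
        ∑ κ ∈ K, visits μ κ.1 κ.2 (planOf κ) (fun f => f ≤ t) n (insert y A) ≤
        ∑ κ ∈ K.filter (fun κ => κ.2 ∈ A), min (visitProb μ κ.1 (planOf κ) n (insert y A)) t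
          + (t * planBound + t * (planBound + 4 ^ 12 * planBound) * n) := by
      intro y hy
      refine (ih (insert y A)).trans ?_
      rw [← add_assoc]
      refine add_le_add_left ?_ _
      have h2 : K.filter (fun κ => κ.2 ∈ insert y A) ⊆
          K.filter (fun κ => κ.2 ∈ A) ∪ K.filter (fun κ => dist1 y κ.2 ≤ 12) := by
        intro κ hκ
        simp only [Finset.mem_union, Finset.mem_filter, Finset.mem_insert] at hκ ⊢
        rcases hκ with ⟨h1, h2 | h2⟩
        · refine Or.inr ⟨h1, ?_⟩
          rw [h2, dist1_self]; norm_num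
        · exact Or.inl ⟨h1, h2⟩
      refine (Finset.sum_le_sum_of_subset_of_nonneg h2 fun κ _ _ => hmin κ _).trans ?_
      refine (le_add_of_nonneg_right (Finset.sum_nonneg
        (s := K.filter (fun κ => κ.2 ∈ A) ∩ K.filter (fun κ => dist1 y κ.2 ≤ 12))
        fun κ _ => hmin κ (insert y A))).trans ?_
      rw [Finset.sum_union_inter]
      refine add_le_add_right ?_ _
      refine (Finset.sum_le_card_nsmul _ _ t fun κ _ => min_le_right _ _).trans ?_
      rw [nsmul_eq_mul, mul_comm]
      exact mul_le_mul_of_nonneg_left (Nat.cast_le.2 (card_near_le hK y)) ht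
    have h2 : stepOp μ (fun B => ∑ κ ∈ K, visits μ κ.1 κ.2 (planOf κ) (fun f => f ≤ t) n B) A ≤
        ∑ κ ∈ K.filter (fun κ => κ.2 ∈ A),
          stepOp μ (fun B => min (visitProb μ κ.1 (planOf κ) n B) t) A
          + (t * planBound + t * (planBound + 4 ^ 12 * planBound) * n) := by
      refine (hμ.stepOp_mono (ψ := fun B => ∑ κ ∈ K.filter (fun κ => κ.2 ∈ A),
        min (visitProb μ κ.1 (planOf κ) n B) t
          + (t * planBound + t * (planBound + 4 ^ 12 * planBound) * n)) h1).trans ?_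
      rw [stepOp_add, stepOp_sum]
      refine add_le_add_right ?_ _
      rw [stepOp, ← Finset.sum_mul]
      exact mul_le_of_le_one_left (by positivity) (hμ.sum_bdryF_le_one A)
    have h3 : ∑ κ ∈ K, restrictedRate μ κ.1 κ.2 (planOf κ) (fun f => f ≤ t) (n + 1) A =
        ∑ κ ∈ K.filter (fun κ => κ.2 ∈ A),
          restrictedRate μ κ.1 κ.2 (planOf κ) (fun f => f ≤ t) (n + 1) A := by
      rw [Finset.sum_filter]
      refine Finset.sum_congr rfl fun κ _ => ?_
      split_ifs with h
      · rfl
      · rw [restrictedRate, if_neg fun h' => h h'.1]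
    have h4 := Finset.sum_le_sum (s := K.filter (fun κ => κ.2 ∈ A)) fun κ hκ =>
      hμ.restrictedRate_add_stepOp_min_le (x := κ.1) (s := planOf κ) ht
        (Finset.mem_filter.1 hκ).2 n
    rw [Finset.sum_add_distrib, Finset.sum_add_distrib, ← Finset.mul_sum] at h4
    have h5 := mul_le_mul_of_nonneg_left (hμ.sum_sum_zoneHarm_le hK A) ht
    simp only [visits_succ]
    rw [Finset.sum_add_distrib, ← stepOp_sum, h3]
    push_cast
    linarith

/-- The plans attached to a cluster are visited at total rate at least one. -/
lemma one_le_sum_zoneRate (hA : A.Nonempty)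
    (hKA : ∀ x, ∀ a ∈ A, dist1 x a = 12 → (x, a) ∈ K) :
    1 ≤ ∑ κ ∈ K.filter (fun κ => κ.2 ∈ A), zoneRate μ κ.1 (planOf κ) A := by
  set C : Finset (Fin 2 → ℤ) := A.biUnion fun a => ball1 a 12 with hC
  have hmemC : ∀ z, z ∈ C ↔ ∃ a ∈ A, dist1 z a ≤ 12 := fun z => by
    simp only [hC, Finset.mem_biUnion, mem_ball1]
  have hCne : C.Nonempty := by
    obtain ⟨a, ha⟩ := hA
    exact ⟨a, (hmemC a).2 ⟨a, ha, by rw [dist1_self]; norm_num⟩⟩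
  rw [← hμ.sum_eq_one hCne]
  have hnear : ∀ x ∈ C, (∃ a ∈ A, dist1 x a < 12) → μ C x = 0 := by
    intro x hx hxa
    refine hμ.eq_zero_of_barrier (S := {z | ∃ a ∈ A, dist1 z a < 12})
      (C.finite_toSet.subset fun z ⟨a, ha, h⟩ => (hmemC z).2 ⟨a, ha, h.le⟩) ?_ hx hxa
    rintro u hu - z hz ⟨a, ha, h⟩
    refine hu ((hmemC u).2 ⟨a, ha, ?_⟩)
    have := mem_latNbrs.1 hz
    have := dist1_triangle u z a
    omega
  classical
  set G := C.filter fun x => ¬ ∃ a ∈ A, dist1 x a < 12 with hG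
  have hGsum : ∑ x ∈ C, μ C x = ∑ x ∈ G, μ C x := by
    rw [hG, Finset.sum_filter]
    refine Finset.sum_congr rfl fun x hx => ?_
    split_ifs with h
    · exact hnear x hx h
    · rfl
  have hch : ∀ x ∈ G, ∃ a ∈ A, dist1 x a = 12 := fun x hx => by
    obtain ⟨h1, h2⟩ := Finset.mem_filter.1 hx
    obtain ⟨a, ha, h⟩ := (hmemC x).1 h1
    exact ⟨a, ha, le_antisymm h (not_lt.1 fun h' => h2 ⟨a, ha, h'⟩)⟩
  choose! g hgA hg using hch
  rw [hGsum]
  have hle : ∀ x ∈ G, μ C x ≤ zoneRate μ x (planOf (x, g x)) A := by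
    intro x hx
    have hfar : Far x A := fun z hz => not_lt.1 fun h =>
      (Finset.mem_filter.1 hx).2 ⟨z, hz, by rwa [dist1_comm]⟩
    rw [zoneRate, if_pos hfar]
    refine hμ.le_of_subset (Finset.union_subset (fun z hz => ?_) fun z hz => ?_)
      (Finset.mem_union_right _ self_mem_planZone)
    · obtain ⟨-, w, hw, hwz⟩ := mem_bdryF.1 hz
      exact (hmemC z).2 ⟨w, hw, by rw [dist1_comm]; omega⟩
    · exact (hmemC z).2 ⟨g x, hgA x hx,
        (isPlan_planOf (κ := (x, g x)) (hg x hx)).planZone_subset (hg x hx) hz⟩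
  refine (Finset.sum_le_sum hle).trans ?_
  rw [← Finset.sum_image (f := fun κ : (Fin 2 → ℤ) × (Fin 2 → ℤ) => zoneRate μ κ.1 (planOf κ) A)
    (g := fun x => (x, g x)) fun x _ y _ h => (Prod.ext_iff.1 h).1]
  refine Finset.sum_le_sum_of_subset_of_nonneg (fun κ hκ => ?_) fun κ _ _ => hμ.zoneRate_nonneg
  obtain ⟨x, hx, rfl⟩ := Finset.mem_image.1 hκ
  exact Finset.mem_filter.2 ⟨hKA x _ (hgA x hx) (hg x hx), hgA x hx⟩

lemma le_sum_visits (n : ℕ) (A : Finset (Fin 2 → ℤ)) (hA : A.Nonempty)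
    (hKA : ∀ x a, (∃ z ∈ A, dist1 a z ≤ n) → dist1 x a = 12 → (x, a) ∈ K) :
    (n : ℝ) ≤ ∑ κ ∈ K, visits μ κ.1 κ.2 (planOf κ) (fun _ => True) n A := by
  induction n generalizing A with
  | zero => simp [visits, total]
  | succ n ih =>
    simp only [visits_succ]
    rw [Finset.sum_add_distrib, ← stepOp_sum]
    have h1 := hμ.one_le_sum_zoneRate hA fun x a ha hxa =>
      hKA x a ⟨a, ha, by rw [dist1_self]; omega⟩ hxa
    have h2 : (n : ℝ) ≤ stepOp μ (fun B => ∑ κ ∈ K,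
        visits μ κ.1 κ.2 (planOf κ) (fun _ => True) n B) A := by
      rw [← hμ.stepOp_const (n : ℝ) hA]
      refine hμ.stepOp_mono fun y hy => ih _ (Finset.insert_nonempty _ _) ?_
      rintro x a ⟨z, hz, hza⟩ hxa
      obtain ⟨-, w, hw, hwy⟩ := mem_bdryF.1 hy
      refine hKA x a ?_ hxa
      rcases Finset.mem_insert.1 hz with rfl | hz
      · have := dist1_triangle a z w
        have := dist1_comm z w
        exact ⟨w, hw, by omega⟩
      · exact ⟨z, hz, by omega⟩
    have h3 : ∑ κ ∈ K, restrictedRate μ κ.1 κ.2 (planOf κ) (fun _ => True) (n + 1) A =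
        ∑ κ ∈ K.filter (fun κ => κ.2 ∈ A), zoneRate μ κ.1 (planOf κ) A := by
      rw [Finset.sum_filter]
      simp [restrictedRate]
    rw [h3]
    push_cast
    linarith

/-- From every cluster, the process eventually encloses a site with probability bounded below. -/
lemma exists_createProb_ge : ∃ c > 0, ∀ A : Finset (Fin 2 → ℤ), A.Nonempty →
    ∃ n, c ≤ createProb μ n A := by
  obtain ⟨M, hM⟩ : ∃ M : ℝ, M = planBound := ⟨_, rfl⟩
  have hM1 : 1 ≤ M := by
    rw [hM]; exact_mod_cast (by unfold planBound; norm_num : 1 ≤ planBound)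
  obtain ⟨t, ht⟩ : ∃ t : ℝ, t = 1 / (2 * (M + 4 ^ 12 * M)) := ⟨_, rfl⟩
  have ht0 : 0 < t := by rw [ht]; positivity
  have htM : t * (M + 4 ^ 12 * M) = 1 / 2 := by rw [ht]; field_simp
  obtain ⟨c, hc⟩ : ∃ c : ℝ, c = (1 / 4 : ℝ) ^ 12 *
    (((1 / 4 : ℝ) ^ 12) ^ 13 * t ^ 13 / (Nat.factorial 13 : ℝ)) := ⟨_, rfl⟩
  have hc0 : 0 < c := by rw [hc]; positivity
  refine ⟨c / (8 * M), by positivity, fun A hA => ?_⟩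
  obtain ⟨n, hn⟩ := exists_nat_ge (max 14 (4 * (A.card * M * t)))
  have hn14 := (le_max_left _ _).trans hn
  have hnA := (le_max_right _ _).trans hn
  refine ⟨n + 14, ?_⟩
  set B : Finset (Fin 2 → ℤ) := A.biUnion fun z => ball1 z n with hB
  set K : Finset ((Fin 2 → ℤ) × (Fin 2 → ℤ)) :=
    ((B.biUnion fun a => ball1 a 12) ×ˢ B).filter fun κ => dist1 κ.1 κ.2 = 12 with hKdef
  have hK : IsPairs K := fun κ hκ => (Finset.mem_filter.1 hκ).2
  have hKA : ∀ x a, (∃ z ∈ A, dist1 a z ≤ n) → dist1 x a = 12 → (x, a) ∈ K := by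
    rintro x a ⟨z, hz, hza⟩ hxa
    have haB : a ∈ B := Finset.mem_biUnion.2 ⟨z, hz, mem_ball1.2 hza⟩
    exact Finset.mem_filter.2 ⟨Finset.mem_product.2
      ⟨Finset.mem_biUnion.2 ⟨a, haB, mem_ball1.2 hxa.le⟩, haB⟩, hxa⟩
  clear_value K
  have h1 := hμ.le_sum_visits n A hA hKA
  have h2 := hμ.sum_visits_le hK ht0.le n A
  rw [← hM, htM] at h2
  have h3 : ∑ κ ∈ K.filter (fun κ => κ.2 ∈ A), min (visitProb μ κ.1 (planOf κ) n A) t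
      ≤ A.card * M * t := by
    refine (Finset.sum_le_card_nsmul _ _ t fun κ _ => min_le_right _ _).trans ?_
    rw [nsmul_eq_mul]
    refine mul_le_mul_of_nonneg_right ?_ ht0.le
    rw [hM, ← Nat.cast_mul]
    refine Nat.cast_le.2 ?_
    have hcard : (A.biUnion fun y => K.filter fun κ => dist1 y κ.2 ≤ 12).card
        ≤ A.card * planBound :=
      Finset.card_biUnion_le_card_mul _ _ planBound fun y _ => card_near_le hK y
    refine le_trans (Finset.card_le_card fun κ hκ => ?_) hcard
    obtain ⟨h1, h2⟩ := Finset.mem_filter.1 hκ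
    refine Finset.mem_biUnion.2 ⟨κ.2, h2, Finset.mem_filter.2 ⟨h1, ?_⟩⟩
    rw [dist1_self]; norm_num
  have h4 : ∑ κ ∈ K, visits μ κ.1 κ.2 (planOf κ) (fun _ => True) n A =
      ∑ κ ∈ K, visits μ κ.1 κ.2 (planOf κ) (fun f => f ≤ t) n A +
        ∑ κ ∈ K, visits μ κ.1 κ.2 (planOf κ) (fun f => ¬ f ≤ t) n A := by
    rw [← Finset.sum_add_distrib]
    exact Finset.sum_congr rfl fun κ _ => visits_add_not _ _ _
  have h5 : c * ∑ κ ∈ K, visits μ κ.1 κ.2 (planOf κ) (fun f => ¬ f ≤ t) n A ≤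
      ∑ κ ∈ K, completions μ (planOf κ) (n + 14) A := by
    rw [Finset.mul_sum, hc]
    exact Finset.sum_le_sum fun κ hκ =>
      hμ.mul_visits_le_completions (isPlan_planOf (hK κ hκ)) ht0.le n A
  have h6 := hμ.sum_completions_le hK (n + 14) A
  have h7 := mul_le_mul_of_nonneg_left (hμ.total_createRate_le (n + 14) A)
    (show 0 ≤ M by linarith)
  rw [← hM] at h6
  have h8 : (n : ℝ) / 4 ≤ ∑ κ ∈ K, visits μ κ.1 κ.2 (planOf κ) (fun f => ¬ f ≤ t) n A := by
    linarith
  have h9 := mul_le_mul_of_nonneg_left h8 hc0.le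
  have h10 := hμ.createProb_nonneg (n + 14) A
  rw [div_le_iff₀ (by positivity)]
  push_cast at h7
  have h11 : c * (n / 4) ≤ M * ((n + 14) * createProb μ (n + 14) A) := by linarith
  have h12 : M * ((n + 14) * createProb μ (n + 14) A)
      ≤ M * (2 * n * createProb μ (n + 14) A) := by
    refine mul_le_mul_of_nonneg_left (mul_le_mul_of_nonneg_right (by linarith) h10) (by linarith)
  have h13 : (n : ℝ) * c ≤ n * (createProb μ (n + 14) A * (8 * M)) := by linarith
  exact le_of_mul_le_mul_left h13 (by linarith)

end IsHarmonicFromInfinity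

end LowerBound

section Holes

variable {μ : Finset (Fin 2 → ℤ) → (Fin 2 → ℤ) → ℝ} {A : Finset (Fin 2 → ℤ)} {y : Fin 2 → ℤ}
  {k : ℕ}

lemma adjZ_iff {u v : Fin 2 → ℤ} : adjZ u v ↔ dist1 u v = 1 := by
  unfold adjZ dist1
  rw [Fin.sum_univ_two, Int.abs_eq_natAbs, Int.abs_eq_natAbs]
  omega

lemma reach_mono {d : ℕ} {S T : Set (Fin d → ℤ)} (h : S ⊆ T) {u v : Fin d → ℤ}
    (huv : reach S u v) : reach T u v :=
  huv.lift id fun _ _ ⟨h1, h2, h3⟩ => ⟨h h1, h h2, h3⟩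

/-- Two adjacent sites outside a cluster lie in the same component of the complement. -/
lemma reach_step {x u v : Fin 2 → ℤ} (h : reach (↑A)ᶜ x u) (hu : u ∉ A) (hv : v ∉ A)
    (huv : dist1 u v = 1) : reach (↑A)ᶜ x v :=
  h.tail ⟨hu, hv, adjZ_iff.2 huv⟩

/-- The indicator of the clusters with fewer than `k` holes. -/
noncomputable def fewHoles (k : ℕ) (A : Finset (Fin 2 → ℤ)) : ℝ :=
  {A | (holes A).encard < k}.indicator 1 A

lemma fewHoles_eq_zero (h : (k : ℕ∞) ≤ (holes A).encard) : fewHoles k A = 0 :=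
  Set.indicator_of_notMem (s := {A : Finset (Fin 2 → ℤ) | (holes A).encard < k}) (not_lt.2 h) _

lemma fewHoles_eq_one (h : (holes A).encard < k) : fewHoles k A = 1 :=
  Set.indicator_of_mem (s := {A : Finset (Fin 2 → ℤ) | (holes A).encard < k}) h _

lemma fewHoles_nonneg (k : ℕ) (A : Finset (Fin 2 → ℤ)) : 0 ≤ fewHoles k A :=
  Set.indicator_nonneg (fun _ _ => zero_le_one) _

lemma fewHoles_le_one (k : ℕ) (A : Finset (Fin 2 → ℤ)) : fewHoles k A ≤ 1 :=
  Set.indicator_le_self' (f := 1) (fun _ _ => zero_le_one) A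

namespace IsHarmonicFromInfinity

variable (hμ : IsHarmonicFromInfinity μ)
include hμ

/-- A site of positive harmonic measure does not lie in a hole. -/
lemma notMem_hole (hy : y ∈ bdryF latNbrs A) (h0 : μ (bdryF latNbrs A) y ≠ 0)
    {H : Set (Fin 2 → ℤ)} (hH : H ∈ holes A) : y ∉ H := by
  obtain ⟨x, hx, rfl, hfin⟩ := hH
  intro hyH
  refine h0 (hμ.eq_zero_of_barrier (S := {z | reach (↑A)ᶜ x z} ∪ ↑A)
    (hfin.union A.finite_toSet) ?_ hy (Or.inl hyH))
  intro u hu huS z hz hzS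
  have huA : u ∉ A := fun h => huS (Or.inr h)
  have hzu : dist1 z u = 1 := mem_latNbrs.1 (mem_latNbrs_comm.1 hz)
  by_cases hzA : z ∈ A
  · exact hu (mem_bdryF.2 ⟨huA, z, hzA, hzu⟩)
  · exact huS (Or.inl (reach_step (hzS.resolve_right hzA) hzA huA hzu))

lemma holes_subset (hy : y ∈ bdryF latNbrs A) (h0 : μ (bdryF latNbrs A) y ≠ 0) :
    holes A ⊆ holes (insert y A) := by
  intro H hH
  have hyH := hμ.notMem_hole hy h0 hH
  obtain ⟨x, hx, rfl, hfin⟩ := hH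
  have hxy : x ≠ y := fun h => hyH (h ▸ Relation.ReflTransGen.refl)
  refine ⟨x, by simp [hxy, hx], Set.Subset.antisymm (fun z hz => ?_) (fun z hz => ?_), hfin⟩
  · change reach _ x z
    induction hz with
    | refl => exact Relation.ReflTransGen.refl
    | tail hab hbc ih =>
      rename_i b c
      have hb : b ≠ y := fun h => hyH (h ▸ hab)
      have hc : c ≠ y := fun h => hyH (h ▸ hab.tail hbc)
      refine ih.tail ⟨?_, ?_, hbc.2.2⟩
      · simpa [hb] using hbc.1
      · simpa [hc] using hbc.2.1
  · refine reach_mono ?_ hz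
    rw [Set.compl_subset_compl, Finset.coe_subset]
    exact Finset.subset_insert _ _

lemma encard_holes_le (hy : y ∈ bdryF latNbrs A) (h0 : μ (bdryF latNbrs A) y ≠ 0) :
    (holes A).encard ≤ (holes (insert y A)).encard :=
  Set.encard_le_encard (hμ.holes_subset hy h0)

lemma encard_holes_add_one_le (hy : y ∈ bdryF latNbrs A) (h0 : μ (bdryF latNbrs A) y ≠ 0)
    (hc : Creates A y) : (holes A).encard + 1 ≤ (holes (insert y A)).encard := by
  obtain ⟨o, ho, hsub, hyo⟩ := hc
  have hyA := (mem_bdryF.1 hy).1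
  have hoA : o ∉ A := fun h => ho (Finset.mem_insert_of_mem h)
  have h1 : ({o} : Set (Fin 2 → ℤ)) ∉ holes A := by
    rintro ⟨x, hx, hH, -⟩
    have hxo : reach (↑A)ᶜ x o := hH.subset (Set.mem_singleton o)
    have : y ∈ ({o} : Set (Fin 2 → ℤ)) :=
      hH.superset (reach_step hxo hoA hyA (mem_latNbrs.1 hyo))
    exact ho (by rw [← Set.mem_singleton_iff.1 this]; exact Finset.mem_insert_self _ _)
  have h2 : ({o} : Set (Fin 2 → ℤ)) ∈ holes (insert y A) := by
    refine ⟨o, ho, Set.Subset.antisymm ?_ (fun z hz => ?_), Set.finite_singleton o⟩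
    · rintro _ rfl
      exact Relation.ReflTransGen.refl
    · change reach _ o z at hz
      rcases Relation.ReflTransGen.cases_head hz with h | ⟨c, ⟨-, hcA, hoc⟩, -⟩
      · exact h.symm
      · exact absurd (hsub (mem_latNbrs.2 (adjZ_iff.1 hoc))) hcA
  rw [← Set.encard_insert_of_notMem h1]
  exact Set.encard_le_encard (Set.insert_subset h2 (hμ.holes_subset hy h0))

lemma stepOp_mono_of_ne_zero {φ ψ : Finset (Fin 2 → ℤ) → ℝ}
    (h : ∀ y ∈ bdryF latNbrs A, μ (bdryF latNbrs A) y ≠ 0 → φ (insert y A) ≤ ψ (insert y A)) :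
    stepOp μ φ A ≤ stepOp μ ψ A := by
  refine Finset.sum_le_sum fun y hy => ?_
  by_cases h0 : μ (bdryF latNbrs A) y = 0
  · simp [h0]
  · exact mul_le_mul_of_nonneg_left (h y hy h0) (hμ.nonneg hy)

lemma stepOp_fewHoles_le (k : ℕ) (A : Finset (Fin 2 → ℤ)) :
    stepOp μ (fewHoles k) A ≤ fewHoles k A := by
  rcases le_or_gt (k : ℕ∞) (holes A).encard with h | h
  · rw [fewHoles_eq_zero h]
    refine (hμ.stepOp_mono_of_ne_zero (ψ := fun _ => 0) fun y hy h0 => ?_).trans_eq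
      (by simp [stepOp])
    rw [fewHoles_eq_zero (h.trans (hμ.encard_holes_le hy h0))]
  · rw [fewHoles_eq_one h]
    refine (hμ.stepOp_mono (ψ := fun _ => 1) fun y _ => fewHoles_le_one _ _).trans ?_
    simpa [stepOp] using hμ.sum_bdryF_le_one A

/-- A bounded nonnegative harmonic function of the cluster vanishing once there are `k` holes is
zero. -/
lemma eq_zero_of_stepOp_eq {L : Finset (Fin 2 → ℤ) → ℝ} (hL0 : ∀ A, 0 ≤ L A)
    (hL1 : ∀ A, L A ≤ 1) (hL : ∀ A, stepOp μ L A = L A)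
    (hk : ∀ A, (k : ℕ∞) ≤ (holes A).encard → L A = 0) (hA : A.Nonempty) : L A = 0 := by
  obtain ⟨c, hc0, hc⟩ := hμ.exists_createProb_ge
  have hc1 : c ≤ 1 := by
    obtain ⟨n, hn⟩ := hc A hA
    exact hn.trans (hμ.createProb_le_one n A)
  suffices h : ∀ j : ℕ, ∀ A : Finset (Fin 2 → ℤ), A.Nonempty →
      (k : ℕ∞) ≤ (holes A).encard + j → L A = 0 from h k A hA le_add_self
  intro j
  induction j with
  | zero => exact fun A _ h => hk A (by simpa using h)
  | succ j ih =>
    have key : ∀ b : ℝ, 0 ≤ b → (∀ A : Finset (Fin 2 → ℤ), A.Nonempty →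
        (k : ℕ∞) ≤ (holes A).encard + (j + 1 : ℕ) → L A ≤ b) → ∀ (n : ℕ)
        (A : Finset (Fin 2 → ℤ)), A.Nonempty → (k : ℕ∞) ≤ (holes A).encard + (j + 1 : ℕ) →
        L A ≤ (1 - createProb μ n A) * b := by
      intro b hb hLb n
      induction n with
      | zero => intro A hA hAk; simpa [createProb] using hLb A hA hAk
      | succ n ihn =>
        intro A hA hAk
        have h1 : ∀ y ∈ bdryF latNbrs A, μ (bdryF latNbrs A) y * L (insert y A) ≤
            μ (bdryF latNbrs A) y * b - (μ (bdryF latNbrs A) y *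
              open Classical in if Creates A y then 1 else createProb μ n (insert y A)) * b := by
          intro y hy
          by_cases h0 : μ (bdryF latNbrs A) y = 0
          · simp [h0]
          · rw [mul_assoc, ← mul_sub]
            refine mul_le_mul_of_nonneg_left ?_ (hμ.nonneg hy)
            split_ifs with hcr
            · rw [one_mul, sub_self]
              refine (ih _ (Finset.insert_nonempty _ _) (hAk.trans ?_)).le
              rw [Nat.cast_succ, add_comm (j : ℕ∞), ← add_assoc]
              gcongr
              exact hμ.encard_holes_add_one_le hy h0 hcr
            · refine (ihn _ (Finset.insert_nonempty _ _) (hAk.trans ?_)).trans_eq (by ring)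
              exact add_le_add_left (hμ.encard_holes_le hy h0) _
        have h2 := Finset.sum_le_sum h1
        rw [Finset.sum_sub_distrib, ← Finset.sum_mul, ← Finset.sum_mul,
          hμ.sum_eq_one (bdryF_nonempty hA)] at h2
        rw [← hL A, sub_mul]
        exact h2
    have hpow : ∀ (i : ℕ) (A : Finset (Fin 2 → ℤ)), A.Nonempty →
        (k : ℕ∞) ≤ (holes A).encard + (j + 1 : ℕ) → L A ≤ (1 - c) ^ i := by
      intro i
      induction i with
      | zero => intro A _ _; simpa using hL1 A
      | succ i ihi =>
        intro A hA hAk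
        obtain ⟨n, hn⟩ := hc A hA
        have hb : 0 ≤ (1 - c) ^ i := pow_nonneg (by linarith) i
        refine (key _ hb ihi n A hA hAk).trans ?_
        rw [pow_succ']
        exact mul_le_mul_of_nonneg_right (by linarith) hb
    intro A hA hAk
    refine le_antisymm (ge_of_tendsto' (tendsto_pow_atTop_nhds_zero_of_lt_one (r := 1 - c)
      (by linarith) (by linarith)) fun i => hpow i A hA hAk) (hL0 A)

/-- Iterating the transition operator on the indicator of having few holes gives zero. -/
lemma tendsto_iterate_stepOp_fewHoles (k : ℕ) (hA : A.Nonempty) :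
    Tendsto (fun n => (stepOp μ)^[n] (fewHoles k) A) atTop (𝓝 0) := by
  have h0 : ∀ n A, 0 ≤ (stepOp μ)^[n] (fewHoles k) A := by
    intro n
    induction n with
    | zero => exact fewHoles_nonneg k
    | succ n ih =>
      intro A
      rw [Function.iterate_succ_apply']
      exact hμ.stepOp_nonneg ih A
  have hsucc : ∀ n A, (stepOp μ)^[n + 1] (fewHoles k) A ≤ (stepOp μ)^[n] (fewHoles k) A := by
    intro n
    induction n with
    | zero => exact hμ.stepOp_fewHoles_le k
    | succ n ih =>
      intro A
      simp only [Function.iterate_succ_apply'] at ih ⊢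
      exact hμ.stepOp_mono fun y _ => ih _
  have hanti : ∀ A, Antitone fun n => (stepOp μ)^[n] (fewHoles k) A := fun A =>
    antitone_nat_of_succ_le fun n => hsucc n A
  have hlim : ∀ A, Tendsto (fun n => (stepOp μ)^[n] (fewHoles k) A) atTop
      (𝓝 (⨅ n, (stepOp μ)^[n] (fewHoles k) A)) := fun A =>
    tendsto_atTop_ciInf (hanti A) ⟨0, Set.forall_mem_range.2 fun n => h0 n A⟩
  have hle : ∀ A, ⨅ n, (stepOp μ)^[n] (fewHoles k) A ≤ fewHoles k A := fun A =>
    (hanti A).le_of_tendsto (hlim A) 0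
  have hnn : ∀ A, 0 ≤ ⨅ n, (stepOp μ)^[n] (fewHoles k) A := fun A =>
    Real.iInf_nonneg fun n => h0 n A
  have hL := hμ.eq_zero_of_stepOp_eq (k := k)
    (L := fun A => ⨅ n, (stepOp μ)^[n] (fewHoles k) A) hnn
    (fun A => (hle A).trans (fewHoles_le_one k A))
    (fun A => by
      refine tendsto_nhds_unique (f := fun n => (stepOp μ)^[n + 1] (fewHoles k) A) ?_
        ((hlim A).comp (tendsto_add_atTop_nat 1))
      simp only [Function.iterate_succ_apply']
      exact tendsto_finsetSum _ fun y _ => (hlim _).const_mul _)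
    (fun A h => le_antisymm ((hle A).trans_eq (fewHoles_eq_zero h)) (hnn A)) hA
  rw [← hL]
  exact hlim A

end IsHarmonicFromInfinity

end Holes

section ClusterLaw

variable {Ω : Type*} [MeasurableSpace Ω] {P : Measure Ω} {E : ℕ → Ω → Finset (Fin 2 → ℤ)}
  {Y : ℕ → Ω → (Fin 2 → ℤ)} {μ : Finset (Fin 2 → ℤ) → (Fin 2 → ℤ) → ℝ}
  {e : Finset (Fin 2 → ℤ)}

lemma measure_cluster_succ_le
    (hstep : ∀ n ω, E (n + 1) ω = insert (Y (n + 1) ω) (E n ω))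
    (hbd : ∀ n ω, Y (n + 1) ω ∈ bdryF latNbrs (E n ω)) (n : ℕ) (B : Finset (Fin 2 → ℤ)) :
    P {ω | E (n + 1) ω = B} ≤ ∑' A, ∑ y ∈ bdryF latNbrs A,
      if insert y A = B then P {ω | E n ω = A ∧ Y (n + 1) ω = y} else 0 := by
  have h : {ω | E (n + 1) ω = B} ⊆ ⋃ A, ⋃ y ∈ bdryF latNbrs A,
      {ω | insert y A = B ∧ E n ω = A ∧ Y (n + 1) ω = y} := by
    intro ω hω
    simp only [Set.mem_iUnion]
    exact ⟨E n ω, Y (n + 1) ω, hbd n ω, (hstep n ω).symm.trans hω, rfl, rfl⟩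
  refine (measure_mono h).trans ((measure_iUnion_le _).trans (ENNReal.tsum_le_tsum fun A => ?_))
  refine (measure_biUnion_finset_le _ _).trans (Finset.sum_le_sum fun y _ => ?_)
  split_ifs with hB <;> simp [hB]

/-- The law of the cluster after `n` steps is dominated by the iterated transition operator. -/
lemma tsum_measure_cluster_mul_le [IsProbabilityMeasure P] (hμ : IsHarmonicFromInfinity μ)
    (h0 : ∀ ω, E 0 ω = e)
    (hstep : ∀ n ω, E (n + 1) ω = insert (Y (n + 1) ω) (E n ω))
    (hbd : ∀ n ω, Y (n + 1) ω ∈ bdryF latNbrs (E n ω))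
    (hlaw : ∀ (n : ℕ) (A : Finset (Fin 2 → ℤ)), ∀ y ∈ bdryF latNbrs A,
      P {ω | E n ω = A ∧ Y (n + 1) ω = y}
        = ENNReal.ofReal (μ (bdryF latNbrs A) y) * P {ω | E n ω = A})
    (n : ℕ) {φ : Finset (Fin 2 → ℤ) → ℝ} (hφ : ∀ A, 0 ≤ φ A) :
    ∑' A, P {ω | E n ω = A} * ENNReal.ofReal (φ A)
      ≤ ENNReal.ofReal ((stepOp μ)^[n] φ e) := by
  induction n generalizing φ with
  | zero =>
    rw [tsum_eq_single e fun A hA => by simp [h0, hA.symm]]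
    simp [h0]
  | succ n ih =>
    rw [Function.iterate_succ_apply]
    refine le_trans ?_ (ih fun A => hμ.stepOp_nonneg hφ A)
    calc ∑' B, P {ω | E (n + 1) ω = B} * ENNReal.ofReal (φ B)
        ≤ ∑' B, ∑' A, ∑ y ∈ bdryF latNbrs A,
            (if insert y A = B then P {ω | E n ω = A ∧ Y (n + 1) ω = y} else 0)
              * ENNReal.ofReal (φ B) := by
          refine ENNReal.tsum_le_tsum fun B => ?_
          simp only [← Finset.sum_mul]
          rw [ENNReal.tsum_mul_right]
          exact mul_le_mul_left (measure_cluster_succ_le hstep hbd n B) _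
      _ = ∑' A, ∑ y ∈ bdryF latNbrs A,
            P {ω | E n ω = A ∧ Y (n + 1) ω = y} * ENNReal.ofReal (φ (insert y A)) := by
          rw [ENNReal.tsum_comm]
          refine tsum_congr fun A => ?_
          rw [Summable.tsum_finsetSum fun _ _ => ENNReal.summable]
          refine Finset.sum_congr rfl fun y _ => ?_
          rw [tsum_eq_single (insert y A) fun B hB => by rw [if_neg hB.symm, zero_mul],
            if_pos rfl]
      _ = ∑' A, P {ω | E n ω = A} * ENNReal.ofReal (stepOp μ φ A) := by
          refine tsum_congr fun A => ?_
          rw [stepOp, ENNReal.ofReal_sum_of_nonneg fun y hy => mul_nonneg (hμ.nonneg hy) (hφ _),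
            Finset.mul_sum]
          refine Finset.sum_congr rfl fun y hy => ?_
          rw [hlaw n A y hy, ENNReal.ofReal_mul (hμ.nonneg hy)]
          ring
      _ ≤ _ := le_rfl

lemma measure_few_holes_le [IsProbabilityMeasure P] (hμ : IsHarmonicFromInfinity μ)
    (h0 : ∀ ω, E 0 ω = e)
    (hstep : ∀ n ω, E (n + 1) ω = insert (Y (n + 1) ω) (E n ω))
    (hbd : ∀ n ω, Y (n + 1) ω ∈ bdryF latNbrs (E n ω))
    (hlaw : ∀ (n : ℕ) (A : Finset (Fin 2 → ℤ)), ∀ y ∈ bdryF latNbrs A,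
      P {ω | E n ω = A ∧ Y (n + 1) ω = y}
        = ENNReal.ofReal (μ (bdryF latNbrs A) y) * P {ω | E n ω = A}) (k n : ℕ) :
    P {ω | (holes (E n ω)).encard < k} ≤ ENNReal.ofReal ((stepOp μ)^[n] (fewHoles k) e) := by
  refine le_trans ?_ (tsum_measure_cluster_mul_le hμ h0 hstep hbd hlaw n (fewHoles_nonneg k))
  have h : {ω | (holes (E n ω)).encard < k} ⊆
      ⋃ A, {ω | (holes A).encard < k ∧ E n ω = A} := fun ω hω =>
    Set.mem_iUnion.2 ⟨E n ω, hω, rfl⟩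
  refine (measure_mono h).trans ((measure_iUnion_le _).trans (ENNReal.tsum_le_tsum fun A => ?_))
  by_cases hA : (holes A).encard < k
  · simp [hA, fewHoles_eq_one hA]
  · simp [hA]

/-- Almost surely the process never uses a site of zero harmonic measure. -/
lemma ae_harmonic_ne_zero
    (hbd : ∀ n ω, Y (n + 1) ω ∈ bdryF latNbrs (E n ω))
    (hlaw : ∀ (n : ℕ) (A : Finset (Fin 2 → ℤ)), ∀ y ∈ bdryF latNbrs A,
      P {ω | E n ω = A ∧ Y (n + 1) ω = y}
        = ENNReal.ofReal (μ (bdryF latNbrs A) y) * P {ω | E n ω = A}) :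
    ∀ᵐ ω ∂P, ∀ n, μ (bdryF latNbrs (E n ω)) (Y (n + 1) ω) ≠ 0 := by
  have h : ∀ᵐ ω ∂P, ∀ (n : ℕ) (A : Finset (Fin 2 → ℤ)) (y : Fin 2 → ℤ),
      y ∈ bdryF latNbrs A → μ (bdryF latNbrs A) y = 0 → ¬ (E n ω = A ∧ Y (n + 1) ω = y) := by
    refine ae_all_iff.2 fun n => ae_all_iff.2 fun A => ae_all_iff.2 fun y => ?_
    by_cases hy : y ∈ bdryF latNbrs A
    · by_cases hz : μ (bdryF latNbrs A) y = 0
      · simp only [hy, hz, forall_true_left]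
        rw [ae_iff]
        simpa [hz] using hlaw n A y hy
      · simp [hz]
    · simp [hy]
  filter_upwards [h] with ω hω n hn
  exact hω n _ _ (hbd n ω) hn ⟨rfl, rfl⟩

end ClusterLaw

/-- **External DLA on ℤ² has infinitely many holes (Eberz-Wagner).**  For any finite
connected subset `e` of `ℤ²`, the number of holes `H_n` of the external DLA cluster
started from `E_0 = e` converges to infinity almost surely. -/
theorem external_dla_holes_tendsto_infinity
    {Ω : Type*} [MeasurableSpace Ω] (P : Measure Ω) [IsProbabilityMeasure P]
    (E : ℕ → Ω → Finset (Fin 2 → ℤ)) (Y : ℕ → Ω → (Fin 2 → ℤ))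
    -- the harmonic measure from infinity on `ℤ²` (the SRW is recurrent)
    (μh : Finset (Fin 2 → ℤ) → (Fin 2 → ℤ) → ℝ)
    (hμ : ∀ A : Finset (Fin 2 → ℤ), A.Nonempty → ∀ y ∈ A,
      Tendsto (fun x => hitMeas latNbrs (↑A) x y) cofinite (𝓝 (μh A y)))
    -- the initial cluster is an arbitrary finite connected subset `e` of `ℤ²`
    (e : Finset (Fin 2 → ℤ)) (he : e.Nonempty)
    (hconn : ∀ x ∈ e, ∀ y ∈ e, reach (↑e) x y)
    (h0 : ∀ ω, E 0 ω = e)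
    (hstep : ∀ n ω, E (n+1) ω = insert (Y (n+1) ω) (E n ω))
    (hbd : ∀ n ω, Y (n+1) ω ∈ bdryF latNbrs (E n ω))
    (hlaw : ∀ (n : ℕ) (A : Finset (Fin 2 → ℤ)), ∀ y ∈ bdryF latNbrs A,
      P {ω | E n ω = A ∧ Y (n+1) ω = y}
        = ENNReal.ofReal (μh (bdryF latNbrs A) y) * P {ω | E n ω = A}) :
    ∀ᵐ ω ∂P, ∀ k : ℕ, ∀ᶠ n : ℕ in atTop, (k : ℕ∞) ≤ (holes (E n ω)).encard := by
  have hμ' : IsHarmonicFromInfinity μh := hμ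
  refine ae_all_iff.2 fun k => ?_
  have hne := ae_harmonic_ne_zero (P := P) hbd hlaw
  have hnull : P {ω | ∀ n, (holes (E n ω)).encard < k} = 0 := by
    have hlim := ENNReal.tendsto_ofReal (hμ'.tendsto_iterate_stepOp_fewHoles k he)
    rw [ENNReal.ofReal_zero] at hlim
    exact le_antisymm (ge_of_tendsto' hlim fun n => (measure_mono (Set.ofPred_subset_ofPred.2
      fun ω hω => hω n)).trans
      (measure_few_holes_le hμ' h0 hstep hbd hlaw k n)) zero_le
  filter_upwards [hne, measure_eq_zero_iff_ae_notMem.1 hnull] with ω hω hnot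
  have hmono : Monotone fun n => (holes (E n ω)).encard := monotone_nat_of_le_succ fun n => by
    rw [hstep n ω]
    exact hμ'.encard_holes_le (hbd n ω) (hω n)
  obtain ⟨m, hm⟩ := not_forall.1 hnot
  exact eventually_atTop.2 ⟨m, fun n hn => (not_lt.1 hm).trans (hmono hn)⟩
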